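/- Let K be a field of arbitrary characteristic and let A be an affine line arrangement in K² with χ(A,t) = (t − n)(t − n − r), where n ∈ ℤ_{≥0} and r ∈ ℤ_{≥1}. Assume that A contains a free subarrangement B with exp₀(B) = (n − 2, n − 2). Then A is free if and only if n_H = n or n_H = n + r for some line H ∈ A. -/

import Mathlib

open MvPolynomial

variable {K : Type*} [Field K]

/-- A subset of `K × K` is an affine line: the zero set of a nonzero degree-one equation. -/
def IsAffineLine (L : Set (K × K)) : Prop :=
  ∃ a b c : K, (a, b) ≠ (0, 0) ∧ L = {p : K × K | a * p.1 + b * p.2 + c = 0}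

/-- An affine line arrangement: a finite set of affine lines in `K²`. -/
def IsLineArr (A : Finset (Set (K × K))) : Prop :=
  ∀ L ∈ A, IsAffineLine L

open Classical in
/-- The second Betti number `b₂(A)` of a line arrangement, via Whitney's theorem:
`b₂(A) = ∑ (-1)^{|B|}` over the subsets `B ⊆ A` with `|B| ≥ 2` and `⋂ B ≠ ∅`. -/
noncomputable def b2 (A : Finset (Set (K × K))) : ℤ :=
  ∑ B ∈ A.powerset.filter
      (fun B : Finset (Set (K × K)) => 2 ≤ B.card ∧ (⋂ L ∈ B, (L : Set (K × K))).Nonempty),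
    (-1 : ℤ) ^ B.card

/-- The characteristic polynomial `χ(A,t) = t² − |A|·t + b₂(A)`, evaluated at `t : ℂ`. -/
noncomputable def chi (A : Finset (Set (K × K))) (t : ℂ) : ℂ :=
  t ^ 2 - (A.card : ℂ) * t + (b2 A : ℂ)

/-- `nOn A H = |A ∩ H|`: the number of intersection points, lying on the line `H`, of `H`
with the lines of `A` other than `H`. -/
noncomputable def nOn (A : Finset (Set (K × K))) (H : Set (K × K)) : ℕ :=
  Set.ncard {p : K × K | p ∈ H ∧ ∃ L ∈ A, L ≠ H ∧ p ∈ L}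

/-- The linear form `a·x + b·y + c·z` in `K[x,y,z]`. -/
noncomputable def lin3 (a b c : K) : MvPolynomial (Fin 3) K :=
  C a * X 0 + C b * X 1 + C c * X 2

/-- The action on `f` of the derivation with coefficient vector `θ`. -/
noncomputable def applyDer3 (θ : Fin 3 → MvPolynomial (Fin 3) K)
    (f : MvPolynomial (Fin 3) K) : MvPolynomial (Fin 3) K :=
  ∑ i, θ i * pderiv i f

/-- `θ` belongs to `D(cA)`, the logarithmic derivation module of the cone of `A`:
`θ(α_H) ∈ S·α_H` for every `H ∈ cA`, where `cA` consists of the homogenizations of the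
lines of `A` together with the plane `z = 0`. -/
def InDCone (A : Finset (Set (K × K))) (θ : Fin 3 → MvPolynomial (Fin 3) K) : Prop :=
  (∀ L ∈ A, ∀ a b c : K, (a, b) ≠ (0, 0) →
      L = {p : K × K | a * p.1 + b * p.2 + c = 0} →
      ∃ g, applyDer3 θ (lin3 a b c) = g * lin3 a b c) ∧
  (∃ g, applyDer3 θ (X 2) = g * (X 2 : MvPolynomial (Fin 3) K))

/-- A homogeneous derivation of degree `d` on `K[x,y,z]`. -/
def HomogDer3 (θ : Fin 3 → MvPolynomial (Fin 3) K) (d : ℕ) : Prop :=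
  ∀ i, (θ i).IsHomogeneous d

/-- `A` is free with exponents `exp₀(A) = (d₁, d₂)`: `D(cA)` is a free module with a
homogeneous basis consisting of the Euler derivation `x∂ₓ + y∂_y + z∂_z` and two
derivations of degrees `d₁` and `d₂`. -/
def IsFreeExp (A : Finset (Set (K × K))) (d₁ d₂ : ℕ) : Prop :=
  ∃ θ₁ θ₂ : Fin 3 → MvPolynomial (Fin 3) K,
    InDCone A θ₁ ∧ InDCone A θ₂ ∧ HomogDer3 θ₁ d₁ ∧ HomogDer3 θ₂ d₂ ∧
    ∀ θ : Fin 3 → MvPolynomial (Fin 3) K, InDCone A θ →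
      ∃! cfs : MvPolynomial (Fin 3) K × MvPolynomial (Fin 3) K × MvPolynomial (Fin 3) K,
        θ = fun j => cfs.1 * X j + cfs.2.1 * θ₁ j + cfs.2.2 * θ₂ j

/-- `A` is free (with some exponents). -/
def IsFree (A : Finset (Set (K × K))) : Prop := ∃ d₁ d₂ : ℕ, IsFreeExp A d₁ d₂

/-- `A` is free with (integer-valued) exponents `exp₀(A) = (d₁, d₂)`. -/
def IsFreeExpZ (A : Finset (Set (K × K))) (d₁ d₂ : ℤ) : Prop :=
  ∃ e₁ e₂ : ℕ, (e₁ : ℤ) = d₁ ∧ (e₂ : ℤ) = d₂ ∧ IsFreeExp A e₁ e₂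

/-- A line `a·x + b·y + c = 0` with a chosen point `(p, q)` on it and a complementary direction
`(u, v)`, normalised by `u·b - v·a = 1`. -/
structure LineFrame (K : Type*) [Field K] where
  a : K
  b : K
  c : K
  u : K
  v : K
  p : K
  q : K
  det : u * b - v * a = 1
  mem : a * p + b * q + c = 0

namespace LineFrame

/-- The affine line of a frame. -/
def line (F : LineFrame K) : Set (K × K) := {x | F.a * x.1 + F.b * x.2 + F.c = 0}

/-- The linear form defining the line. -/
noncomputable def form (F : LineFrame K) : MvPolynomial (Fin 3) K := lin3 F.a F.b F.c

/-- The linear form that restricts to the parameter of the line. -/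
noncomputable def tau (F : LineFrame K) : MvPolynomial (Fin 3) K :=
  lin3 F.u F.v (-(F.u * F.p + F.v * F.q))

/-- Dehomogenized restriction to the line, parametrized by `t ↦ (p + b·t, q - a·t)`. -/
noncomputable def res (F : LineFrame K) : MvPolynomial (Fin 3) K →ₐ[K] Polynomial K :=
  aeval ![Polynomial.C F.p + Polynomial.C F.b * Polynomial.X,
    Polynomial.C F.q - Polynomial.C F.a * Polynomial.X, 1]

/-- The derivation with coefficients `θ`, applied to the linear form of the line. -/
noncomputable def evA (F : LineFrame K) :
    (MvPolynomial (Fin 3) K × MvPolynomial (Fin 3) K) →ₗ[MvPolynomial (Fin 3) K]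
      MvPolynomial (Fin 3) K :=
  (C F.a : MvPolynomial (Fin 3) K) • LinearMap.fst _ _ _ +
    (C F.b : MvPolynomial (Fin 3) K) • LinearMap.snd _ _ _

/-- The derivation with coefficients `θ`, applied to the parameter form of the line. -/
noncomputable def evT (F : LineFrame K) :
    (MvPolynomial (Fin 3) K × MvPolynomial (Fin 3) K) →ₗ[MvPolynomial (Fin 3) K]
      MvPolynomial (Fin 3) K :=
  (C F.u : MvPolynomial (Fin 3) K) • LinearMap.fst _ _ _ +
    (C F.v : MvPolynomial (Fin 3) K) • LinearMap.snd _ _ _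

/-- Homogenization of a polynomial of degree at most `k` on the line. -/
noncomputable def lift (F : LineFrame K) (k : ℕ) (s : Polynomial K) : MvPolynomial (Fin 3) K :=
  ∑ j ∈ Finset.range (k + 1), C (s.coeff j) * (F.tau ^ j * X 2 ^ (k - j))

/-- The coefficient of the parameter of `F` in the linear form of `G`. -/
def slope (F G : LineFrame K) : K := G.a * F.b - G.b * F.a

/-- The constant coefficient of the restriction to `F` of the linear form of `G`. -/
def offset (F G : LineFrame K) : K := G.a * F.p + G.b * F.q + G.c

/-- The coefficient of the form of `F` in the linear form of `G`. -/
def cross (F G : LineFrame K) : K := G.b * F.u - G.a * F.v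

theorem evA_apply (F : LineFrame K) (θ : MvPolynomial (Fin 3) K × MvPolynomial (Fin 3) K) :
    F.evA θ = C F.a * θ.1 + C F.b * θ.2 := rfl

theorem evT_apply (F : LineFrame K) (θ : MvPolynomial (Fin 3) K × MvPolynomial (Fin 3) K) :
    F.evT θ = C F.u * θ.1 + C F.v * θ.2 := rfl

theorem C_det (F : LineFrame K) :
    (C F.u * C F.b - C F.v * C F.a : MvPolynomial (Fin 3) K) = 1 := by
  rw [← C_mul, ← C_mul, ← C_sub, F.det, C_1]

theorem fst_eq (F : LineFrame K) (θ : MvPolynomial (Fin 3) K × MvPolynomial (Fin 3) K) :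
    θ.1 = C F.b * F.evT θ - C F.v * F.evA θ := by
  rw [evA_apply, evT_apply]
  linear_combination (-θ.1) * F.C_det

theorem snd_eq (F : LineFrame K) (θ : MvPolynomial (Fin 3) K × MvPolynomial (Fin 3) K) :
    θ.2 = C F.u * F.evA θ - C F.a * F.evT θ := by
  rw [evA_apply, evT_apply]
  linear_combination (-θ.2) * F.C_det

theorem evA_eq (F G : LineFrame K) (θ : MvPolynomial (Fin 3) K × MvPolynomial (Fin 3) K) :
    G.evA θ = C (slope F G) * F.evT θ + C (cross F G) * F.evA θ := by
  rw [evA_apply, F.fst_eq θ, F.snd_eq θ, slope, cross]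
  simp only [C_sub, C_mul]
  ring

theorem form_eq (F G : LineFrame K) :
    G.form = C (slope F G) * F.tau + C (cross F G) * F.form + C (offset F G) * X 2 := by
  have h := F.det
  have h1 : G.a = slope F G * F.u + cross F G * F.a := by
    rw [slope, cross]; linear_combination (-G.a) * h
  have h2 : G.b = slope F G * F.v + cross F G * F.b := by
    rw [slope, cross]; linear_combination (-G.b) * h
  have h3 : G.c = slope F G * (-(F.u * F.p + F.v * F.q)) + cross F G * F.c + offset F G := by
    rw [slope, cross, offset]
    linear_combination (G.a * F.p + G.b * F.q) * h + (-G.b * F.u + G.a * F.v) * F.mem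
  rw [form, form, tau, lin3, lin3, lin3]
  conv_lhs => rw [h1, h2, h3]
  simp only [C_add, C_mul]
  ring

theorem res_form_self (F : LineFrame K) : F.res F.form = 0 := by
  have h := congrArg (Polynomial.C : K → Polynomial K) F.mem
  simp only [Polynomial.C_add, Polynomial.C_mul, Polynomial.C_0] at h
  simp only [res, form, lin3, map_add, map_mul, aeval_X, algHom_C, Polynomial.algebraMap_eq]
  simp
  linear_combination h

theorem res_tau (F : LineFrame K) : F.res F.tau = Polynomial.X := by
  have h := congrArg (Polynomial.C : K → Polynomial K) F.det
  simp only [Polynomial.C_sub, Polynomial.C_mul, Polynomial.C_1] at h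
  simp only [res, tau, lin3, map_add, map_mul, aeval_X, algHom_C, Polynomial.algebraMap_eq]
  simp
  linear_combination Polynomial.X * h

theorem res_C (F : LineFrame K) (r : K) : F.res (C r) = Polynomial.C r := by
  simp [algHom_C]

theorem res_X2 (F : LineFrame K) : F.res (X 2) = 1 := by
  simp [res]

theorem res_form (F G : LineFrame K) :
    F.res G.form = Polynomial.C (slope F G) * Polynomial.X + Polynomial.C (offset F G) := by
  rw [F.form_eq G]
  simp only [map_add, map_mul, res_form_self, res_tau, res_C, res_X2]
  ring

theorem form_isHomogeneous (F : LineFrame K) : F.form.IsHomogeneous 1 :=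
  ((isHomogeneous_C_mul_X _ _).add (isHomogeneous_C_mul_X _ _)).add (isHomogeneous_C_mul_X _ _)

theorem tau_isHomogeneous (F : LineFrame K) : F.tau.IsHomogeneous 1 :=
  ((isHomogeneous_C_mul_X _ _).add (isHomogeneous_C_mul_X _ _)).add (isHomogeneous_C_mul_X _ _)

theorem form_ne_zero (F : LineFrame K) : F.form ≠ 0 := by
  intro h
  have h0 : coeff (Finsupp.single 0 1) F.form = F.a := by
    simp [form, lin3, coeff_C_mul, coeff_X, Finsupp.single_left_inj]
  have h1 : coeff (Finsupp.single 1 1) F.form = F.b := by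
    simp [form, lin3, coeff_C_mul, coeff_X, Finsupp.single_left_inj]
  rw [h, coeff_zero] at h0 h1
  have := F.det
  rw [← h0, ← h1] at this
  simp at this

theorem lift_isHomogeneous (F : LineFrame K) (k : ℕ) (s : Polynomial K) :
    (F.lift k s).IsHomogeneous k := by
  refine IsHomogeneous.sum _ _ _ fun j hj => IsHomogeneous.C_mul ?_ _
  have h := (F.tau_isHomogeneous.pow j).mul ((isHomogeneous_X K (2 : Fin 3)).pow (k - j))
  rwa [one_mul, one_mul, Nat.add_sub_cancel' (by simpa [Nat.lt_succ_iff] using hj)] at h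

theorem res_lift (F : LineFrame K) {k : ℕ} {s : Polynomial K} (hs : s.natDegree ≤ k) :
    F.res (F.lift k s) = s := by
  rw [lift, map_sum]
  simp only [map_mul, map_pow, res_tau, res_X2, res_C, one_pow, mul_one]
  exact (s.as_sum_range_C_mul_X_pow' (Nat.lt_succ_of_le hs)).symm

theorem lift_add (F : LineFrame K) (k : ℕ) (s t : Polynomial K) :
    F.lift k (s + t) = F.lift k s + F.lift k t := by
  simp only [lift, Polynomial.coeff_add, C_add, add_mul, Finset.sum_add_distrib]

theorem lift_zero (F : LineFrame K) (k : ℕ) : F.lift k 0 = 0 := by simp [lift]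

theorem lift_C_mul (F : LineFrame K) (k : ℕ) (r : K) (s : Polynomial K) :
    F.lift k (Polynomial.C r * s) = C r * F.lift k s := by
  simp only [lift, Polynomial.coeff_C_mul, C_mul, Finset.mul_sum, mul_assoc]

theorem lift_X_mul (F : LineFrame K) (k : ℕ) (s : Polynomial K) :
    F.lift (k + 1) (Polynomial.X * s) = F.lift k s * F.tau := by
  rw [lift, Finset.sum_range_succ', lift, Finset.sum_mul]
  simp only [Polynomial.coeff_X_mul, Polynomial.coeff_X_mul_zero, C_0, zero_mul, add_zero,
    Nat.add_sub_add_right]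
  exact Finset.sum_congr rfl fun j _ => by ring

theorem lift_succ (F : LineFrame K) {k : ℕ} {s : Polynomial K} (hs : s.natDegree ≤ k) :
    F.lift (k + 1) s = F.lift k s * X 2 := by
  rw [lift, Finset.sum_range_succ, Polynomial.coeff_eq_zero_of_natDegree_lt (by omega), lift,
    Finset.sum_mul, C_0, zero_mul, add_zero]
  refine Finset.sum_congr rfl fun j hj => ?_
  rw [Nat.succ_sub (by simpa [Nat.lt_succ_iff] using hj), pow_succ]
  ring

theorem exists_linear_eq (F : LineFrame K) {f : MvPolynomial (Fin 3) K}
    (hf : f ∈ homogeneousSubmodule (Fin 3) K 1) :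
    ∃ r s : K, F.form ∣ f - (C r * F.tau + C s * X 2) := by
  rw [homogeneousSubmodule_one_eq_span_X] at hf
  have hmem := congrArg (C : K → MvPolynomial (Fin 3) K) F.mem
  have hdet := F.C_det
  simp only [C_add, C_mul, C_0] at hmem
  induction hf using Submodule.span_induction with
  | mem x hx =>
    obtain ⟨i, rfl⟩ := hx
    fin_cases i
    · refine ⟨F.b, F.p, -C F.v, ?_⟩
      simp only [form, tau, lin3, C_add, C_mul, C_neg, Fin.zero_eta]
      linear_combination (-X 0 + C F.p * X 2) * hdet + (C F.v * X 2) * hmem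
    · refine ⟨-F.a, F.q, C F.u, ?_⟩
      simp only [form, tau, lin3, C_add, C_mul, C_neg, Fin.mk_one]
      linear_combination (-X 1 + C F.q * X 2) * hdet - (C F.u * X 2) * hmem
    · exact ⟨0, 1, 0, by simp⟩
  | zero => exact ⟨0, 0, by simp⟩
  | add x y _ _ hx hy =>
    obtain ⟨r, s, h⟩ := hx
    obtain ⟨r', s', h'⟩ := hy
    refine ⟨r + r', s + s', ?_⟩
    convert dvd_add h h' using 1
    simp only [C_add]
    ring
  | smul e x _ hx =>
    obtain ⟨r, s, h⟩ := hx
    refine ⟨e * r, e * s, ?_⟩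
    convert h.mul_left (C e) using 1
    simp only [C_mul, smul_eq_C_mul]
    ring

/-- Division by a linear form, with remainder the homogenization of a polynomial on the line. -/
theorem exists_eq_lift_add (F : LineFrame K) {k : ℕ} {f : MvPolynomial (Fin 3) K}
    (hf : f.IsHomogeneous k) :
    ∃ s : Polynomial K, s.natDegree ≤ k ∧ F.form ∣ f - F.lift k s := by
  rw [← mem_homogeneousSubmodule, ← homogeneousSubmodule_one_pow] at hf
  induction k generalizing f with
  | zero =>
    rw [pow_zero, Submodule.mem_one] at hf
    obtain ⟨r, rfl⟩ := hf
    exact ⟨Polynomial.C r, by simp, 0, by simp [lift, algebraMap_eq]⟩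
  | succ k ih =>
    rw [pow_succ] at hf
    induction hf using Submodule.mul_induction_on' with
    | mem_mul_mem g hg h hh =>
      obtain ⟨s, hs, d, hd⟩ := ih hg
      obtain ⟨r, r', e, he⟩ := F.exists_linear_eq hh
      refine ⟨Polynomial.C r * (Polynomial.X * s) + Polynomial.C r' * s, ?_, ?_⟩
      · refine Polynomial.natDegree_add_le_of_degree_le ?_ ?_
        · refine (Polynomial.natDegree_C_mul_le _ _).trans (Polynomial.natDegree_mul_le.trans ?_)
          rw [Polynomial.natDegree_X]
          omega
        · exact (Polynomial.natDegree_C_mul_le _ _).trans (by omega)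
      · rw [lift_add, lift_C_mul, lift_C_mul, lift_X_mul, lift_succ F hs]
        refine ⟨d * h + F.lift k s * e, ?_⟩
        linear_combination h * hd + F.lift k s * he
    | add x _ y _ hx hy =>
      obtain ⟨s, hs, h⟩ := hx
      obtain ⟨s', hs', h'⟩ := hy
      refine ⟨s + s', Polynomial.natDegree_add_le_of_degree_le hs hs', ?_⟩
      convert dvd_add h h' using 1
      rw [lift_add]
      ring

theorem res_eq_zero_of_dvd (F : LineFrame K) {f : MvPolynomial (Fin 3) K} (h : F.form ∣ f) :
    F.res f = 0 := by
  obtain ⟨g, rfl⟩ := h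
  rw [map_mul, res_form_self, zero_mul]

theorem natDegree_res_le (F : LineFrame K) {k : ℕ} {f : MvPolynomial (Fin 3) K}
    (hf : f.IsHomogeneous k) : (F.res f).natDegree ≤ k := by
  obtain ⟨s, hs, h⟩ := F.exists_eq_lift_add hf
  have := F.res_eq_zero_of_dvd h
  rw [map_sub, F.res_lift hs, sub_eq_zero] at this
  rwa [this]

/-- A homogeneous polynomial is divisible by the form of a line iff it vanishes on the line. -/
theorem form_dvd_iff (F : LineFrame K) {k : ℕ} {f : MvPolynomial (Fin 3) K}
    (hf : f.IsHomogeneous k) : F.form ∣ f ↔ F.res f = 0 := by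
  refine ⟨F.res_eq_zero_of_dvd, fun h0 => ?_⟩
  obtain ⟨s, hs, h⟩ := F.exists_eq_lift_add hf
  have := F.res_eq_zero_of_dvd h
  rw [map_sub, F.res_lift hs, h0, zero_sub, neg_eq_zero] at this
  rwa [this, lift_zero, sub_zero] at h

end LineFrame

theorem homogeneousComponent_mul_of_isHomogeneous {f : MvPolynomial (Fin 3) K} {i : ℕ}
    (hf : f.IsHomogeneous i) (g : MvPolynomial (Fin 3) K) (j : ℕ) :
    homogeneousComponent (i + j) (f * g) = f * homogeneousComponent j g := by
  let _ : GradedAlgebra (homogeneousSubmodule (Fin 3) K) := gradedAlgebra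
  have h := DirectSum.coe_decompose_mul_add_of_left_mem (homogeneousSubmodule (Fin 3) K)
    (i := i) (j := j) (a := f) (b := g) hf
  exact (decomposition.decompose'_apply _ _).symm.trans
    (h.trans (congrArg (f * ·) (decomposition.decompose'_apply _ _)))

theorem homogeneousComponent_mul_of_lt {f : MvPolynomial (Fin 3) K} {i : ℕ}
    (hf : f.IsHomogeneous i) (g : MvPolynomial (Fin 3) K) {j : ℕ} (hj : j < i) :
    homogeneousComponent j (f * g) = 0 := by
  let _ : GradedAlgebra (homogeneousSubmodule (Fin 3) K) := gradedAlgebra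
  have h := DirectSum.coe_decompose_mul_of_left_mem_of_not_le (homogeneousSubmodule (Fin 3) K)
    (i := i) (n := j) (a := f) (b := g) hf (by omega)
  exact (decomposition.decompose'_apply _ _).symm.trans h

/-- A cofactor of a homogeneous polynomial by a linear form is homogeneous. -/
theorem isHomogeneous_of_linear_mul {f g : MvPolynomial (Fin 3) K} (hf : f.IsHomogeneous 1)
    (hf0 : f ≠ 0) {k : ℕ} (h : (f * g).IsHomogeneous (k + 1)) : g.IsHomogeneous k := by
  have h1 := homogeneousComponent_eq_self h
  rw [add_comm, homogeneousComponent_mul_of_isHomogeneous hf] at h1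
  rw [← mul_left_cancel₀ hf0 h1]
  exact homogeneousComponent_isHomogeneous _ _

theorem eq_zero_of_linear_mul {f g : MvPolynomial (Fin 3) K} (hf : f.IsHomogeneous 1)
    (hf0 : f ≠ 0) (h : (f * g).IsHomogeneous 0) : g = 0 := by
  have h1 := homogeneousComponent_eq_self h
  rw [homogeneousComponent_mul_of_lt hf _ one_pos] at h1
  exact (mul_eq_zero.mp h1.symm).resolve_left hf0

theorem isHomogeneous_linear_mul_of_linear_mul {f f' g : MvPolynomial (Fin 3) K}
    (hf : f.IsHomogeneous 1) (hf0 : f ≠ 0) (hf' : f'.IsHomogeneous 1) {k : ℕ}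
    (h : (f * g).IsHomogeneous k) : (f' * g).IsHomogeneous k := by
  cases k with
  | zero =>
    rw [eq_zero_of_linear_mul hf hf0 h, mul_zero]
    exact isHomogeneous_zero _ _ _
  | succ k =>
    rw [add_comm]
    exact hf'.mul (isHomogeneous_of_linear_mul hf hf0 h)

namespace LineFrame

/-- The point of the line with parameter `t`. -/
def point (F : LineFrame K) (t : K) : K × K := (F.p + F.b * t, F.q - F.a * t)

/-- The parameter on `F` of its intersection point with `G`. -/
noncomputable def root (F G : LineFrame K) : K := -offset F G / slope F G

theorem point_mem_iff (F G : LineFrame K) (t : K) :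
    F.point t ∈ G.line ↔ slope F G * t + offset F G = 0 := by
  simp only [line, point, slope, offset, Set.mem_ofPred_eq]
  constructor <;> intro h <;> linear_combination h

theorem point_mem (F : LineFrame K) (t : K) : F.point t ∈ F.line := by
  rw [point_mem_iff, slope, offset]
  linear_combination F.mem

theorem exists_point_eq (F : LineFrame K) {x : K × K} (hx : x ∈ F.line) :
    ∃ t, F.point t = x := by
  have hx' : F.a * x.1 + F.b * x.2 + F.c = 0 := hx
  refine ⟨F.u * (x.1 - F.p) + F.v * (x.2 - F.q), Prod.ext ?_ ?_⟩
  · simp only [point]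
    linear_combination (x.1 - F.p) * F.det + F.v * hx' - F.v * F.mem
  · simp only [point]
    linear_combination (x.2 - F.q) * F.det - F.u * hx' + F.u * F.mem

theorem point_injective (F : LineFrame K) : Function.Injective F.point := by
  intro s t h
  have h1 : F.p + F.b * s = F.p + F.b * t := congrArg Prod.fst h
  have h2 : F.q - F.a * s = F.q - F.a * t := congrArg Prod.snd h
  linear_combination F.u * h1 + F.v * h2 - (s - t) * F.det

theorem coord_a (F G : LineFrame K) : G.a = slope F G * F.u + cross F G * F.a := by
  rw [slope, cross]; linear_combination (-G.a) * F.det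

theorem coord_b (F G : LineFrame K) : G.b = slope F G * F.v + cross F G * F.b := by
  rw [slope, cross]; linear_combination (-G.b) * F.det

theorem cross_ne_zero (F G : LineFrame K) (h : slope F G = 0) : cross F G ≠ 0 := by
  intro h'
  have ha := F.coord_a G
  have hb := F.coord_b G
  have := G.det
  rw [ha, hb, h, h'] at this
  simp at this

theorem line_eq_of (F G : LineFrame K) (h : slope F G = 0) (h' : offset F G = 0) :
    G.line = F.line := by
  have h0 := F.cross_ne_zero G h
  have ha := F.coord_a G
  have hb := F.coord_b G
  rw [h, zero_mul, zero_add] at ha hb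
  have hc : G.c = cross F G * F.c := by
    rw [offset] at h'
    rw [ha, hb] at h'
    linear_combination h' - cross F G * F.mem
  ext x
  have : G.a * x.1 + G.b * x.2 + G.c = cross F G * (F.a * x.1 + F.b * x.2 + F.c) := by
    rw [ha, hb, hc]; ring
  rw [line, line, Set.mem_ofPred_eq, Set.mem_ofPred_eq, this, mul_eq_zero, or_iff_right h0]

theorem slope_cross (F G₁ G₂ : LineFrame K) :
    slope F G₂ * cross F G₁ - slope F G₁ * cross F G₂ = slope G₁ G₂ := by
  simp only [slope, cross]
  linear_combination (G₂.a * G₁.b - G₁.a * G₂.b) * F.det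

theorem res_form_ne_zero (F G : LineFrame K) (h : G.line ≠ F.line) : F.res G.form ≠ 0 := by
  intro h0
  rw [res_form] at h0
  refine h (F.line_eq_of G ?_ ?_)
  · simpa using congrArg (Polynomial.coeff · 1) h0
  · simpa using congrArg (Polynomial.coeff · 0) h0

theorem res_form_of_slope_ne_zero (F G : LineFrame K) (h : slope F G ≠ 0) :
    F.res G.form =
      Polynomial.C (slope F G) * (Polynomial.X - Polynomial.C (root F G)) := by
  rw [res_form, root, mul_sub, ← Polynomial.C_mul, mul_div_cancel₀ _ h, Polynomial.C_neg,
    sub_neg_eq_add]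

theorem evA_isHomogeneous (F : LineFrame K)
    {θ : MvPolynomial (Fin 3) K × MvPolynomial (Fin 3) K} {k : ℕ}
    (h₁ : θ.1.IsHomogeneous k) (h₂ : θ.2.IsHomogeneous k) : (F.evA θ).IsHomogeneous k :=
  (h₁.C_mul _).add (h₂.C_mul _)

theorem evT_isHomogeneous (F : LineFrame K)
    {θ : MvPolynomial (Fin 3) K × MvPolynomial (Fin 3) K} {k : ℕ}
    (h₁ : θ.1.IsHomogeneous k) (h₂ : θ.2.IsHomogeneous k) : (F.evT θ).IsHomogeneous k :=
  (h₁.C_mul _).add (h₂.C_mul _)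

theorem exists_coeff_eq {a b : K} (c : K) (hab : (a, b) ≠ (0, 0)) :
    ∃ F : LineFrame K, F.a = a ∧ F.b = b ∧ F.c = c := by
  by_cases hb : b = 0
  · have ha : a ≠ 0 := by
      rintro rfl
      exact hab (by rw [hb])
    exact ⟨⟨a, b, c, 0, -a⁻¹, -c / a, 0, by simp [ha], by field_simp; ring⟩, rfl, rfl, rfl⟩
  · exact ⟨⟨a, b, c, b⁻¹, 0, 0, -c / b, by simp [hb], by field_simp; ring⟩, rfl, rfl, rfl⟩

end LineFrame

theorem exists_eq_prod_form_mul {ι : Type*} (s : Finset ι) (Fr : ι → LineFrame K)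
    (hs : ∀ i ∈ s, ∀ j ∈ s, i ≠ j → (Fr j).line ≠ (Fr i).line) {k : ℕ}
    {f : MvPolynomial (Fin 3) K} (hf : f.IsHomogeneous k) (hdvd : ∀ i ∈ s, (Fr i).form ∣ f) :
    f = 0 ∨ ∃ j g, k = j + s.card ∧ g.IsHomogeneous j ∧ f = (∏ i ∈ s, (Fr i).form) * g := by
  classical
  induction s using Finset.induction_on with
  | empty => exact Or.inr ⟨k, f, by simp, hf, by simp⟩
  | insert i s hi ih =>
    rcases ih (fun i hi j hj => hs i (Finset.mem_insert_of_mem hi) j (Finset.mem_insert_of_mem hj))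
      (fun i hi => hdvd i (Finset.mem_insert_of_mem hi)) with h | ⟨j, g, hk, hg, hfg⟩
    · exact Or.inl h
    have h0 := (Fr i).res_eq_zero_of_dvd (hdvd i (Finset.mem_insert_self _ _))
    rw [hfg, map_mul, map_prod, mul_eq_zero, or_iff_right, ← (Fr i).form_dvd_iff hg] at h0
    · obtain ⟨g', rfl⟩ := h0
      cases j with
      | zero =>
        left
        rw [hfg, eq_zero_of_linear_mul (Fr i).form_isHomogeneous (Fr i).form_ne_zero hg]
        simp
      | succ j =>
        refine Or.inr ⟨j, g', ?_, isHomogeneous_of_linear_mul (Fr i).form_isHomogeneous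
          (Fr i).form_ne_zero hg, ?_⟩
        · rw [Finset.card_insert_of_notMem hi]; omega
        · rw [Finset.prod_insert hi, hfg]; ring
    · rw [Finset.prod_eq_zero_iff]
      rintro ⟨j, hj, hj0⟩
      refine (Fr i).res_form_ne_zero (Fr j) (hs i (Finset.mem_insert_self _ _) j
        (Finset.mem_insert_of_mem hj) ?_) hj0
      rintro rfl
      exact hi hj

theorem exists_frame {L : Set (K × K)} (hL : IsAffineLine L) : ∃ F : LineFrame K, F.line = L := by
  obtain ⟨a, b, c, hab, rfl⟩ := hL
  obtain ⟨F, rfl, rfl, rfl⟩ := LineFrame.exists_coeff_eq c hab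
  exact ⟨F, rfl⟩

open Classical in
/-- A chosen frame of an affine line. -/
noncomputable def frame (L : Set (K × K)) : LineFrame K :=
  if h : ∃ F : LineFrame K, F.line = L then h.choose else ⟨1, 0, 0, 0, -1, 0, 0, by simp, by simp⟩

theorem frame_line {L : Set (K × K)} (hL : IsAffineLine L) : (frame L).line = L := by
  rw [frame, dif_pos (exists_frame hL)]
  exact (exists_frame hL).choose_spec

/-- The logarithmic derivations of the cone that annihilate the form `z` at infinity, given by
their coefficients at `∂ₓ` and `∂_y`. -/
noncomputable def logDer (A : Finset (Set (K × K))) :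
    Submodule (MvPolynomial (Fin 3) K) (MvPolynomial (Fin 3) K × MvPolynomial (Fin 3) K) where
  carrier := {θ | ∀ L ∈ A, (frame L).form ∣ (frame L).evA θ}
  add_mem' := by
    intro x y hx hy L hL
    rw [map_add]
    exact dvd_add (hx L hL) (hy L hL)
  zero_mem' := by
    intro L _
    rw [map_zero]
    exact dvd_zero _
  smul_mem' := by
    intro c x hx L hL
    rw [map_smul, smul_eq_mul]
    exact (hx L hL).mul_left c

theorem mem_logDer {A : Finset (Set (K × K))}
    {θ : MvPolynomial (Fin 3) K × MvPolynomial (Fin 3) K} :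
    θ ∈ logDer A ↔ ∀ L ∈ A, (frame L).form ∣ (frame L).evA θ := Iff.rfl

/-- The homogeneous part of degree `k` of `logDer A`. -/
noncomputable def logDerDeg (A : Finset (Set (K × K))) (k : ℕ) :
    Submodule K (MvPolynomial (Fin 3) K × MvPolynomial (Fin 3) K) :=
  (logDer A).restrictScalars K ⊓
    (homogeneousSubmodule (Fin 3) K k).prod (homogeneousSubmodule (Fin 3) K k)

theorem mem_logDerDeg {A : Finset (Set (K × K))} {k : ℕ}
    {θ : MvPolynomial (Fin 3) K × MvPolynomial (Fin 3) K} :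
    θ ∈ logDerDeg A k ↔ θ ∈ logDer A ∧ θ.1.IsHomogeneous k ∧ θ.2.IsHomogeneous k := Iff.rfl

/-- The lines of `A` that meet `H` in exactly one point. -/
noncomputable def crossers (A : Finset (Set (K × K))) (H : Set (K × K)) :
    Finset (Set (K × K)) :=
  open Classical in A.filter fun L => (frame H).slope (frame L) ≠ 0

/-- The parameters of the intersection points on `H`. -/
noncomputable def pts (A : Finset (Set (K × K))) (H : Set (K × K)) : Finset K :=
  open Classical in (crossers A H).image fun L => (frame H).root (frame L)

/-- The lines of `A` meeting `H` in the point with parameter `t`. -/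
noncomputable def linesAt (A : Finset (Set (K × K))) (H : Set (K × K)) (t : K) :
    Finset (Set (K × K)) :=
  open Classical in (crossers A H).filter fun L => (frame H).root (frame L) = t

/-- The polynomial on `H` vanishing at each intersection point to the order of the number of
lines of `A` through it, minus one. -/
noncomputable def excess (A : Finset (Set (K × K))) (H : Set (K × K)) : Polynomial K :=
  ∏ t ∈ pts A H, (Polynomial.X - Polynomial.C t) ^ ((linesAt A H t).card - 1)

theorem mem_crossers {A : Finset (Set (K × K))} {H L : Set (K × K)} :
    L ∈ crossers A H ↔ L ∈ A ∧ (frame H).slope (frame L) ≠ 0 := by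
  classical
  simp [crossers]

theorem mem_linesAt {A : Finset (Set (K × K))} {H L : Set (K × K)} {t : K} :
    L ∈ linesAt A H t ↔
      L ∈ A ∧ (frame H).slope (frame L) ≠ 0 ∧ (frame H).root (frame L) = t := by
  classical
  simp [linesAt, mem_crossers, and_assoc]

theorem mem_pts {A : Finset (Set (K × K))} {H : Set (K × K)} {t : K} :
    t ∈ pts A H ↔ (linesAt A H t).Nonempty := by
  classical
  simp [pts, linesAt, Finset.Nonempty]

theorem card_linesAt_pos {A : Finset (Set (K × K))} {H : Set (K × K)} {t : K}
    (ht : t ∈ pts A H) : 0 < (linesAt A H t).card := Finset.card_pos.mpr (mem_pts.mp ht)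

theorem excess_monic (A : Finset (Set (K × K))) (H : Set (K × K)) : (excess A H).Monic :=
  Polynomial.monic_prod_of_monic _ _ fun t _ => (Polynomial.monic_X_sub_C t).pow _

theorem excess_mul_nodal (A : Finset (Set (K × K))) (H : Set (K × K)) :
    excess A H * Lagrange.nodal (pts A H) id =
      ∏ L ∈ crossers A H, (Polynomial.X - Polynomial.C ((frame H).root (frame L))) := by
  classical
  rw [excess, Lagrange.nodal_eq, ← Finset.prod_mul_distrib, pts,
    ← Finset.prod_fiberwise_of_maps_to (t := (crossers A H).image
      fun L => (frame H).root (frame L)) (g := fun L => (frame H).root (frame L))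
      (fun L hL => Finset.mem_image_of_mem _ hL)]
  refine Finset.prod_congr rfl fun t ht => ?_
  rw [Finset.prod_congr rfl (g := fun _ => Polynomial.X - Polynomial.C t)
    (fun L hL => by rw [(Finset.mem_filter.mp hL).2]), Finset.prod_const, id, ← pow_succ]
  congr 1
  exact Nat.sub_add_cancel (card_linesAt_pos (A := A) (H := H) ht)

theorem natDegree_excess_add (A : Finset (Set (K × K))) (H : Set (K × K)) :
    (excess A H).natDegree + (pts A H).card = (crossers A H).card := by
  have h := congrArg Polynomial.natDegree (excess_mul_nodal A H)
  rw [(excess_monic A H).natDegree_mul Lagrange.nodal_monic, Lagrange.natDegree_nodal,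
    Polynomial.natDegree_prod_of_monic _ _ fun L _ => Polynomial.monic_X_sub_C _] at h
  simpa using h

theorem nOn_eq_card_pts {A : Finset (Set (K × K))} (hA : IsLineArr A) {H : Set (K × K)}
    (hH : IsAffineLine H) : nOn A H = (pts A H).card := by
  have hset : {x : K × K | x ∈ H ∧ ∃ L ∈ A, L ≠ H ∧ x ∈ L} =
      (frame H).point '' (pts A H : Set K) := by
    ext x
    constructor
    · rintro ⟨hx, L, hL, hLH, hxL⟩
      rw [← frame_line hH] at hx
      obtain ⟨t, rfl⟩ := (frame H).exists_point_eq hx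
      rw [← frame_line (hA L hL), LineFrame.point_mem_iff] at hxL
      refine ⟨t, ?_, rfl⟩
      have hs : (frame H).slope (frame L) ≠ 0 := by
        intro hs
        rw [hs, zero_mul, zero_add] at hxL
        have := (frame H).line_eq_of (frame L) hs hxL
        rw [frame_line hH, frame_line (hA L hL)] at this
        exact hLH this
      refine mem_pts.mpr ⟨L, mem_linesAt.mpr ⟨hL, hs, ?_⟩⟩
      rw [LineFrame.root, div_eq_iff hs]
      linear_combination -hxL
    · rintro ⟨t, ht, rfl⟩
      obtain ⟨L, hL⟩ := mem_pts.mp ht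
      obtain ⟨hLA, hs, hr⟩ := mem_linesAt.mp hL
      have h1 := (frame H).point_mem t
      rw [frame_line hH] at h1
      refine ⟨h1, L, hLA, ?_, ?_⟩
      · rintro rfl
        exact hs (by rw [LineFrame.slope]; ring)
      · rw [← frame_line (hA L hLA), LineFrame.point_mem_iff, ← hr, LineFrame.root,
          mul_div_cancel₀ _ hs]
        ring
  rw [nOn, hset, Set.ncard_image_of_injective _ (frame H).point_injective, Set.ncard_coe_finset]

/-- Degree bound from a divisibility: if `f = e * s` has degree at most `j` and `e` is monic, then
`s` has degree at most `j - deg e`. -/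
theorem mem_degreeLT_of_monic_mul {e s : Polynomial K} (he : e.Monic) {j m : ℕ}
    (h : (e * s).natDegree ≤ j) (hm : j + 1 ≤ m + e.natDegree) : s ∈ Polynomial.degreeLT K m := by
  rw [Polynomial.mem_degreeLT]
  by_cases hs : s = 0
  · rw [hs, Polynomial.degree_zero]
    exact WithBot.bot_lt_coe m
  · rw [he.natDegree_mul' hs] at h
    rw [Polynomial.degree_eq_natDegree hs]
    exact_mod_cast (by omega : s.natDegree < m)

theorem frame_line_ne {L M : Set (K × K)} (hL : IsAffineLine L) (hM : IsAffineLine M)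
    (h : L ≠ M) : (frame L).line ≠ (frame M).line := by
  rwa [frame_line hL, frame_line hM]

theorem slope_ne_zero_of_linesAt {A : Finset (Set (K × K))} (hA : IsLineArr A)
    {H L M : Set (K × K)} {t : K} (hL : L ∈ linesAt A H t) (hM : M ∈ linesAt A H t)
    (hLM : L ≠ M) : (frame L).slope (frame M) ≠ 0 := by
  have key : ∀ N ∈ linesAt A H t, (frame H).point t ∈ (frame N).line := by
    intro N hN
    obtain ⟨_, h2, h3⟩ := mem_linesAt.mp hN
    rw [LineFrame.point_mem_iff, ← h3, LineFrame.root, mul_div_cancel₀ _ h2]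
    ring
  have hpL := key L hL
  have hpM := key M hM
  rw [frame_line (hA L (mem_linesAt.mp hL).1)] at hpL
  intro h0
  obtain ⟨t', ht'⟩ := (frame L).exists_point_eq (x := (frame H).point t)
    (by rwa [frame_line (hA L (mem_linesAt.mp hL).1)])
  rw [← ht', LineFrame.point_mem_iff, h0, zero_mul, zero_add] at hpM
  have := (frame L).line_eq_of _ h0 hpM
  rw [frame_line (hA L (mem_linesAt.mp hL).1), frame_line (hA M (mem_linesAt.mp hM).1)] at this
  exact hLM this.symm

theorem pow_dvd_res_evA {A : Finset (Set (K × K))} (hA : IsLineArr A) {H : Set (K × K)}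
    {k : ℕ} {θ : MvPolynomial (Fin 3) K × MvPolynomial (Fin 3) K} (hθ : θ ∈ logDerDeg A k)
    {t : K} (ht : t ∈ pts A H) :
    (Polynomial.X - Polynomial.C t) ^ ((linesAt A H t).card - 1) ∣
      (frame H).res ((frame H).evA θ) := by
  classical
  obtain ⟨L₁, hL₁⟩ := mem_pts.mp ht
  obtain ⟨hLA, hs₁, hr₁⟩ := mem_linesAt.mp hL₁
  obtain ⟨hD, h1, h2⟩ := mem_logDerDeg.mp hθ
  obtain ⟨e, he⟩ := hD L₁ hLA
  set F := frame H with hF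
  have hform : ∀ L ∈ linesAt A H t, (frame L).form =
      C (F.slope (frame L)) * (F.tau - C t * X 2) + C (F.cross (frame L)) * F.form := by
    intro L hL
    obtain ⟨_, hs, hr⟩ := mem_linesAt.mp hL
    have : F.offset (frame L) = -(F.slope (frame L) * t) := by
      rw [← hr, LineFrame.root, mul_div_cancel₀ _ hs, neg_neg]
    rw [F.form_eq (frame L), this, C_neg, C_mul]
    ring
  have hG : (F.evA θ - F.form * e).IsHomogeneous k := by
    refine (F.evA_isHomogeneous h1 h2).sub (isHomogeneous_linear_mul_of_linear_mul
      (frame L₁).form_isHomogeneous (frame L₁).form_ne_zero F.form_isHomogeneous ?_)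
    rw [← he]
    exact (frame L₁).evA_isHomogeneous h1 h2
  have hdvd : ∀ L ∈ (linesAt A H t).erase L₁, (frame L).form ∣ F.evA θ - F.form * e := by
    intro L hL
    obtain ⟨hne, hL⟩ := Finset.mem_erase.mp hL
    have h := (hD L (mem_linesAt.mp hL).1).sub (dvd_mul_right (frame L).form e)
    have hsl := slope_ne_zero_of_linesAt hA hL hL₁ hne
    have hCs : IsUnit (C ((frame L).slope (frame L₁)) : MvPolynomial (Fin 3) K) :=
      (isUnit_iff_ne_zero.mpr hsl).map C
    rw [← hCs.dvd_mul_left]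
    have := h.mul_left (C (F.slope (frame L₁)))
    convert this using 1
    rw [← F.slope_cross (frame L) (frame L₁), C_sub, C_mul, C_mul]
    rw [F.evA_eq, hform L₁ hL₁] at he
    rw [F.evA_eq (frame L), hform L hL]
    linear_combination (-C (F.slope (frame L))) * he
  have hres : F.res (F.evA θ - F.form * e) = F.res (F.evA θ) := by
    rw [map_sub, map_mul, F.res_form_self, zero_mul, sub_zero]
  rw [← hres]
  rcases exists_eq_prod_form_mul _ frame (fun L hL M hM hLM => frame_line_ne
    (hA M (mem_linesAt.mp (Finset.mem_of_mem_erase hM)).1)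
    (hA L (mem_linesAt.mp (Finset.mem_of_mem_erase hL)).1) hLM.symm) hG hdvd with
    h | ⟨j, g, -, -, h⟩
  · rw [h, map_zero]
    exact dvd_zero _
  · rw [h, map_mul, map_prod]
    refine Dvd.dvd.mul_right ?_ _
    rw [← Finset.card_erase_of_mem hL₁, ← Finset.prod_const]
    refine Finset.prod_dvd_prod_of_dvd _ _ fun L hL => ?_
    obtain ⟨_, hs, hr⟩ := mem_linesAt.mp (Finset.mem_of_mem_erase hL)
    rw [F.res_form_of_slope_ne_zero _ hs, hr]
    exact dvd_mul_left _ _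

theorem slope_eq_zero_of_notMem_crossers {A : Finset (Set (K × K))} {H L : Set (K × K)}
    (hL : L ∈ A) (h : L ∉ crossers A H) : (frame H).slope (frame L) = 0 := by
  by_contra h0
  exact h (mem_crossers.mpr ⟨hL, h0⟩)

theorem crossers_subset (A : Finset (Set (K × K))) (H : Set (K × K)) : crossers A H ⊆ A :=
  fun _ hL => (mem_crossers.mp hL).1

/-- The restriction to `H ∉ A` of `θ(α_H)`, for `θ` logarithmic along `A`. -/
theorem exists_res_evA_eq {A : Finset (Set (K × K))} (hA : IsLineArr A) {H : Set (K × K)}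
    {k : ℕ} {θ : MvPolynomial (Fin 3) K × MvPolynomial (Fin 3) K} (hθ : θ ∈ logDerDeg A k) :
    ∃ s ∈ Polynomial.degreeLT K (k + 1 + (pts A H).card - A.card),
      (frame H).res ((frame H).evA θ) = excess A H * s := by
  classical
  obtain ⟨hD, h1, h2⟩ := mem_logDerDeg.mp hθ
  have hdvd : excess A H ∣ (frame H).res ((frame H).evA θ) :=
    Finset.prod_dvd_of_coprime
      (fun x _ y _ hxy => (Polynomial.isCoprime_X_sub_C_of_isUnit_sub
        (sub_ne_zero.mpr hxy).isUnit).pow)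
      fun t ht => pow_dvd_res_evA hA hθ ht
  obtain ⟨s, hs⟩ := hdvd
  refine ⟨s, ?_, hs⟩
  rcases exists_eq_prod_form_mul (A \ crossers A H) frame (fun L hL M hM hLM => frame_line_ne
    (hA M (Finset.sdiff_subset hM)) (hA L (Finset.sdiff_subset hL)) hLM.symm)
    ((frame H).evA_isHomogeneous h1 h2) (by
      intro L hL
      obtain ⟨hLA, hL⟩ := Finset.mem_sdiff.mp hL
      have h0 := slope_eq_zero_of_notMem_crossers hLA hL
      have hc := (frame H).cross_ne_zero (frame L) h0
      have hCs : IsUnit (C ((frame H).cross (frame L)) : MvPolynomial (Fin 3) K) :=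
        (isUnit_iff_ne_zero.mpr hc).map C
      rw [← hCs.dvd_mul_left]
      have := hD L hLA
      rw [(frame H).evA_eq] at this
      simpa [h0] using this) with h | ⟨j, g, hk, hg, h⟩
  · rw [h, map_zero, eq_comm, mul_eq_zero, or_iff_right (excess_monic A H).ne_zero] at hs
    rw [hs]
    exact zero_mem _
  · refine mem_degreeLT_of_monic_mul (j := j) (excess_monic A H) ?_ ?_
    · rw [← hs, h, map_mul, map_prod, Finset.prod_congr rfl
        (g := fun L => Polynomial.C ((frame H).offset (frame L)))]
      · rw [← map_prod]
        exact (Polynomial.natDegree_C_mul_le _ _).trans ((frame H).natDegree_res_le hg)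
      · intro L hL
        obtain ⟨hLA, hL⟩ := Finset.mem_sdiff.mp hL
        rw [LineFrame.res_form, slope_eq_zero_of_notMem_crossers hLA hL]
        simp
    · have e1 := natDegree_excess_add A H
      have e2 := Finset.card_sdiff_add_card_eq_card (crossers_subset A H)
      omega

/-- The restriction to `H` of the tangential component of a logarithmic derivation. -/
theorem exists_res_evT_eq {A : Finset (Set (K × K))} {H : Set (K × K)} (hH : H ∈ A)
    {k : ℕ} {θ : MvPolynomial (Fin 3) K × MvPolynomial (Fin 3) K} (hθ : θ ∈ logDerDeg A k) :
    ∃ s ∈ Polynomial.degreeLT K (k + 1 - (pts A H).card),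
      (frame H).res ((frame H).evT θ) = Lagrange.nodal (pts A H) id * s := by
  classical
  obtain ⟨hD, h1, h2⟩ := mem_logDerDeg.mp hθ
  have hdvd : Lagrange.nodal (pts A H) id ∣ (frame H).res ((frame H).evT θ) := by
    rw [Lagrange.nodal_eq]
    refine Finset.prod_dvd_of_coprime
      (fun x _ y _ hxy => Polynomial.isCoprime_X_sub_C_of_isUnit_sub
        (sub_ne_zero.mpr hxy).isUnit) fun t ht => ?_
    obtain ⟨L, hL⟩ := mem_pts.mp ht
    obtain ⟨hLA, hs, hr⟩ := mem_linesAt.mp hL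
    have h := hD L hLA
    rw [(frame H).evA_eq] at h
    replace h := map_dvd (frame H).res h
    rw [map_add, map_mul, map_mul, (frame H).res_eq_zero_of_dvd (hD H hH), mul_zero, add_zero,
      LineFrame.res_C, LineFrame.res_form_of_slope_ne_zero _ _ hs, hr] at h
    have hCs : IsUnit (Polynomial.C ((frame H).slope (frame L))) :=
      (isUnit_iff_ne_zero.mpr hs).map Polynomial.C
    rw [hCs.dvd_mul_left] at h
    exact (dvd_mul_left _ _).trans h
  obtain ⟨s, hs⟩ := hdvd
  refine ⟨s, mem_degreeLT_of_monic_mul (j := k) (Lagrange.nodal_monic (s := pts A H) (v := id))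
    ?_ ?_, hs⟩
  · rw [← hs]
    exact (frame H).natDegree_res_le ((frame H).evT_isHomogeneous h1 h2)
  · rw [Lagrange.natDegree_nodal]
    omega

namespace LineFrame

/-- The derivation with given normal component `e` and tangential component `t`. -/
noncomputable def ofEv (F : LineFrame K) (e t : MvPolynomial (Fin 3) K) :
    MvPolynomial (Fin 3) K × MvPolynomial (Fin 3) K :=
  (C F.b * t - C F.v * e, C F.u * e - C F.a * t)

theorem evA_ofEv (F : LineFrame K) (e t : MvPolynomial (Fin 3) K) : F.evA (F.ofEv e t) = e := by
  rw [evA_apply, ofEv]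
  linear_combination e * F.C_det

theorem evT_ofEv (F : LineFrame K) (e t : MvPolynomial (Fin 3) K) : F.evT (F.ofEv e t) = t := by
  rw [evT_apply, ofEv]
  linear_combination t * F.C_det

theorem ext_ev (F : LineFrame K) {θ η : MvPolynomial (Fin 3) K × MvPolynomial (Fin 3) K}
    (hA : F.evA θ = F.evA η) (hT : F.evT θ = F.evT η) : θ = η :=
  Prod.ext (by rw [F.fst_eq θ, F.fst_eq η, hA, hT]) (by rw [F.snd_eq θ, F.snd_eq η, hA, hT])

theorem ofEv_isHomogeneous (F : LineFrame K) {e t : MvPolynomial (Fin 3) K} {k : ℕ}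
    (he : e.IsHomogeneous k) (ht : t.IsHomogeneous k) :
    (F.ofEv e t).1.IsHomogeneous k ∧ (F.ofEv e t).2.IsHomogeneous k :=
  ⟨(ht.C_mul _).sub (he.C_mul _), (he.C_mul _).sub (ht.C_mul _)⟩

/-- Restriction to the line of the normal component. -/
noncomputable def resA (F : LineFrame K) :
    (MvPolynomial (Fin 3) K × MvPolynomial (Fin 3) K) →ₗ[K] Polynomial K :=
  F.res.toLinearMap ∘ₗ F.evA.restrictScalars K

/-- Restriction to the line of the tangential component. -/
noncomputable def resT (F : LineFrame K) :
    (MvPolynomial (Fin 3) K × MvPolynomial (Fin 3) K) →ₗ[K] Polynomial K :=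
  F.res.toLinearMap ∘ₗ F.evT.restrictScalars K

theorem resA_apply (F : LineFrame K) (θ : MvPolynomial (Fin 3) K × MvPolynomial (Fin 3) K) :
    F.resA θ = F.res (F.evA θ) := rfl

theorem resT_apply (F : LineFrame K) (θ : MvPolynomial (Fin 3) K × MvPolynomial (Fin 3) K) :
    F.resT θ = F.res (F.evT θ) := rfl

theorem slope_self (F : LineFrame K) : slope F F = 0 := by rw [slope]; ring

end LineFrame

theorem prod_form_isHomogeneous (s : Finset (Set (K × K))) :
    (∏ L ∈ s, (frame L).form).IsHomogeneous s.card := by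
  have := IsHomogeneous.prod s (fun L => (frame L).form) (fun _ => 1)
    fun L _ => (frame L).form_isHomogeneous
  simpa using this

theorem smul_mem_logDerDeg {A : Finset (Set (K × K))} {i j k : ℕ} (hk : i + j = k)
    {f : MvPolynomial (Fin 3) K} (hf : f.IsHomogeneous i)
    {θ : MvPolynomial (Fin 3) K × MvPolynomial (Fin 3) K} (hθ : θ ∈ logDerDeg A j) :
    f • θ ∈ logDerDeg A k := by
  obtain ⟨h, h1, h2⟩ := mem_logDerDeg.mp hθ
  subst hk
  exact mem_logDerDeg.mpr ⟨(logDer A).smul_mem f h, hf.mul h1, hf.mul h2⟩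

theorem exists_res_prod_form {A : Finset (Set (K × K))} (hA : IsLineArr A) {H : Set (K × K)}
    (hH : IsAffineLine H) (hHA : H ∉ A) :
    ∃ c : K, c ≠ 0 ∧ (frame H).res (∏ L ∈ A, (frame L).form) =
      Polynomial.C c * (excess A H * Lagrange.nodal (pts A H) id) := by
  classical
  refine ⟨(∏ L ∈ A \ crossers A H, (frame H).offset (frame L)) *
    ∏ L ∈ crossers A H, (frame H).slope (frame L), mul_ne_zero ?_ ?_, ?_⟩
  · refine Finset.prod_ne_zero_iff.mpr fun L hL h0 => ?_
    obtain ⟨hLA, hL⟩ := Finset.mem_sdiff.mp hL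
    have := (frame H).line_eq_of (frame L) (slope_eq_zero_of_notMem_crossers hLA hL) h0
    rw [frame_line hH, frame_line (hA L hLA)] at this
    exact hHA (this ▸ hLA)
  · exact Finset.prod_ne_zero_iff.mpr fun L hL => (mem_crossers.mp hL).2
  · rw [← Finset.prod_sdiff (crossers_subset A H), map_mul, map_prod, map_prod, excess_mul_nodal,
      Polynomial.C_mul, map_prod, map_prod, mul_assoc, ← Finset.prod_mul_distrib]
    congr 1
    · refine Finset.prod_congr rfl fun L hL => ?_
      obtain ⟨hLA, hL⟩ := Finset.mem_sdiff.mp hL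
      rw [LineFrame.res_form, slope_eq_zero_of_notMem_crossers hLA hL]
      simp
    · exact Finset.prod_congr rfl fun L hL =>
        LineFrame.res_form_of_slope_ne_zero _ _ (mem_crossers.mp hL).2

theorem exists_res_evA_eq_excess_mul_nodal {A : Finset (Set (K × K))} (hA : IsLineArr A)
    {H : Set (K × K)} (hH : IsAffineLine H) (hHA : H ∉ A) :
    ∃ θ ∈ logDerDeg A A.card,
      (frame H).res ((frame H).evA θ) = excess A H * Lagrange.nodal (pts A H) id := by
  obtain ⟨c, hc, h⟩ := exists_res_prod_form hA hH hHA
  refine ⟨(C c⁻¹ * ∏ L ∈ A, (frame L).form) • (frame H).ofEv 1 0, mem_logDerDeg.mpr ⟨?_, ?_⟩, ?_⟩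
  · intro L hL
    rw [map_smul, smul_eq_mul]
    exact Dvd.dvd.mul_right (Dvd.dvd.mul_left (Finset.dvd_prod_of_mem _ hL) _) _
  · obtain ⟨h1, h2⟩ := (frame H).ofEv_isHomogeneous (isHomogeneous_one (Fin 3) K)
      (isHomogeneous_zero (Fin 3) K 0)
    have := (prod_form_isHomogeneous A).C_mul c⁻¹
    exact ⟨this.mul h1, this.mul h2⟩
  · rw [map_smul, LineFrame.evA_ofEv, smul_eq_mul, mul_one, map_mul, h, LineFrame.res_C,
      ← mul_assoc, ← Polynomial.C_mul, inv_mul_cancel₀ hc, Polynomial.C_1, one_mul]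

theorem exists_res_evA_eq_excess_mul_nodal_erase [DecidableEq K] {A : Finset (Set (K × K))}
    (hA : IsLineArr A) {H : Set (K × K)} (hH : IsAffineLine H) (hHA : H ∉ A) {t : K}
    (ht : t ∈ pts A H) :
    ∃ θ ∈ logDerDeg A (A.card - 1), (frame H).res ((frame H).evA θ) =
      excess A H * Lagrange.nodal ((pts A H).erase t) id := by
  classical
  obtain ⟨c, hc, h⟩ := exists_res_prod_form hA hH hHA
  obtain ⟨L, hL⟩ := mem_pts.mp ht
  obtain ⟨hLA, hs, hr⟩ := mem_linesAt.mp hL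
  set F := frame H with hF
  refine ⟨(C (F.slope (frame L) / c) * ∏ M ∈ A.erase L, (frame M).form) •
    F.ofEv 1 (C (-F.cross (frame L) / F.slope (frame L))), mem_logDerDeg.mpr ⟨?_, ?_⟩, ?_⟩
  · intro M hM
    rw [map_smul, smul_eq_mul]
    by_cases hML : M = L
    · rw [hML, F.evA_eq (frame L), F.evT_ofEv, F.evA_ofEv, ← C_mul, mul_div_cancel₀ _ hs, C_neg]
      simp
    · exact Dvd.dvd.mul_right (Dvd.dvd.mul_left
        (Finset.dvd_prod_of_mem _ (Finset.mem_erase.mpr ⟨hML, hM⟩)) _) _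
  · obtain ⟨h1, h2⟩ := F.ofEv_isHomogeneous (isHomogeneous_one (Fin 3) K)
      (isHomogeneous_C (Fin 3) (-F.cross (frame L) / F.slope (frame L)))
    have := (prod_form_isHomogeneous (A.erase L)).C_mul (F.slope (frame L) / c)
    rw [← Finset.card_erase_of_mem hLA]
    exact ⟨this.mul h1, this.mul h2⟩
  · rw [map_smul, LineFrame.evA_ofEv, smul_eq_mul, mul_one, map_mul, LineFrame.res_C]
    rw [← Finset.mul_prod_erase A _ hLA, map_mul, F.res_form_of_slope_ne_zero _ hs, hr,
      Lagrange.nodal_eq_mul_nodal_erase ht, id] at h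
    have h' := mul_left_cancel₀ (Polynomial.X_sub_C_ne_zero t)
      (show (Polynomial.X - Polynomial.C t) * (Polynomial.C (F.slope (frame L)) *
        F.res (∏ M ∈ A.erase L, (frame M).form)) = (Polynomial.X - Polynomial.C t) *
        (Polynomial.C c * (excess A H * Lagrange.nodal ((pts A H).erase t) id)) by
          linear_combination h)
    rw [div_eq_inv_mul, Polynomial.C_mul, mul_assoc, h', ← mul_assoc, ← Polynomial.C_mul,
      inv_mul_cancel₀ hc, Polynomial.C_1, one_mul]

theorem natDegree_le_of_mem_degreeLT {s : Polynomial K} {k : ℕ}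
    (hs : s ∈ Polynomial.degreeLT K (k + 1)) : s.natDegree ≤ k := by
  rw [Polynomial.mem_degreeLT] at hs
  by_cases h0 : s = 0
  · simp [h0]
  · exact Nat.lt_succ_iff.mp ((Polynomial.natDegree_lt_iff_degree_lt h0).mpr hs)

/-- In large degrees every polynomial allowed by `exists_res_evA_eq` is attained. -/
theorem excess_mul_mem_map_resA {A : Finset (Set (K × K))} (hA : IsLineArr A)
    {H : Set (K × K)} (hH : IsAffineLine H) (hHA : H ∉ A) {k : ℕ} (hk : A.card ≤ k)
    {s : Polynomial K} (hs : s ∈ Polynomial.degreeLT K (k + 1 + (pts A H).card - A.card)) :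
    excess A H * s ∈ (logDerDeg A k).map (frame H).resA := by
  classical
  have hnm : (Lagrange.nodal (pts A H) id : Polynomial K).Monic := Lagrange.nodal_monic
  have hmod : (s %ₘ Lagrange.nodal (pts A H) id).degree < (pts A H).card := by
    have := Polynomial.degree_modByMonic_lt s hnm
    rwa [Lagrange.degree_nodal] at this
  have hdiv : (s /ₘ Lagrange.nodal (pts A H) id).natDegree ≤ k - A.card := by
    rw [Polynomial.natDegree_divByMonic s hnm, Lagrange.natDegree_nodal]
    rw [show k + 1 + (pts A H).card - A.card = k + (pts A H).card - A.card + 1 by omega] at hs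
    have := natDegree_le_of_mem_degreeLT hs
    omega
  rw [← Polynomial.modByMonic_add_div s (Lagrange.nodal (pts A H) id), mul_add]
  refine add_mem ?_ ?_
  · rw [Lagrange.eq_interpolate (Function.injective_id.injOn) hmod,
      Lagrange.interpolate_eq_nodalWeight_mul_nodal_div_X_sub_C, Finset.mul_sum]
    refine sum_mem fun t ht => ?_
    rw [← Lagrange.nodal_erase_eq_nodal_div ht]
    obtain ⟨θ, hθ, h⟩ := exists_res_evA_eq_excess_mul_nodal_erase hA hH hHA ht
    have hpos : 0 < A.card := by
      obtain ⟨L, hL⟩ := mem_pts.mp ht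
      exact Finset.card_pos.mpr ⟨L, (mem_linesAt.mp hL).1⟩
    have hX : (X 2 ^ (k - (A.card - 1)) : MvPolynomial (Fin 3) K).IsHomogeneous
        (k - (A.card - 1)) := by
      simpa using (isHomogeneous_X K (2 : Fin 3)).pow (k - (A.card - 1))
    have hmem := Submodule.mem_map_of_mem (f := (frame H).resA)
      (smul_mem_logDerDeg (Nat.sub_add_cancel (by omega)) hX hθ)
    rw [LineFrame.resA_apply, map_smul, smul_eq_mul, map_mul, map_pow, LineFrame.res_X2, one_pow,
      one_mul, h] at hmem
    have := Submodule.smul_mem _ (Lagrange.nodalWeight (pts A H) id t *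
      (s %ₘ Lagrange.nodal (pts A H) id).eval (id t)) hmem
    rw [Polynomial.smul_eq_C_mul, Polynomial.C_mul] at this
    convert this using 1
    ring
  · obtain ⟨θ, hθ, h⟩ := exists_res_evA_eq_excess_mul_nodal hA hH hHA
    have hmem := Submodule.mem_map_of_mem (f := (frame H).resA)
      (smul_mem_logDerDeg (Nat.sub_add_cancel hk) ((frame H).lift_isHomogeneous (k - A.card)
        (s /ₘ Lagrange.nodal (pts A H) id)) hθ)
    rw [LineFrame.resA_apply, map_smul, smul_eq_mul, map_mul, LineFrame.res_lift _ hdiv, h] at hmem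
    convert hmem using 1
    ring

section Finrank

variable {E E' : Type*} [AddCommGroup E] [Module K E] [AddCommGroup E'] [Module K E']

theorem finrank_map_add_finrank_inf_ker (M : Submodule K E) [FiniteDimensional K M]
    (f : E →ₗ[K] E') :
    Module.finrank K (M.map f) + Module.finrank K (M ⊓ LinearMap.ker f : Submodule K E) =
      Module.finrank K M := by
  rw [← LinearMap.finrank_range_add_finrank_ker (f.domRestrict M), LinearMap.range_domRestrict,
    LinearMap.ker_domRestrict, ← Submodule.map_comap_subtype, Submodule.finrank_map_subtype_eq]

/-- The product of two submodules as a product of modules. -/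
def prodSubmoduleEquiv (p : Submodule K E) (q : Submodule K E') : (p × q) ≃ₗ[K] p.prod q where
  toFun x := ⟨(x.1, x.2), x.1.2, x.2.2⟩
  invFun x := (⟨x.1.1, x.2.1⟩, ⟨x.1.2, x.2.2⟩)
  map_add' _ _ := rfl
  map_smul' _ _ := rfl

theorem finrank_map_of_injective (M : Submodule K E) {f : E →ₗ[K] E'}
    (hf : Function.Injective f) : Module.finrank K (M.map f) = Module.finrank K M :=
  (M.equivMapOfInjective f hf).finrank_eq.symm

end Finrank

theorem finrank_degreeLT (n : ℕ) : Module.finrank K (Polynomial.degreeLT K n) = n := by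
  rw [(Polynomial.degreeLTEquiv K n).finrank_eq, Module.finrank_fin_fun]

theorem finiteDimensional_degreeLT (n : ℕ) : FiniteDimensional K (Polynomial.degreeLT K n) :=
  (Polynomial.degreeLTEquiv K n).symm.finiteDimensional

theorem finiteDimensional_homogeneousSubmodule (k : ℕ) :
    FiniteDimensional K (homogeneousSubmodule (Fin 3) K k) :=
  Module.Finite.iff_fg.mpr (homogeneousSubmodule_fg _ _ k)

theorem finiteDimensional_logDerDeg (A : Finset (Set (K × K))) (k : ℕ) :
    FiniteDimensional K (logDerDeg A k) := by
  have := finiteDimensional_homogeneousSubmodule (K := K) k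
  have : FiniteDimensional K
      ((homogeneousSubmodule (Fin 3) K k).prod (homogeneousSubmodule (Fin 3) K k)) :=
    (prodSubmoduleEquiv _ _).finiteDimensional
  exact Submodule.finiteDimensional_of_le inf_le_right

/-- The polynomials of degree less than `m` multiplied by a fixed polynomial. -/
noncomputable def mulDegreeLT (e : Polynomial K) (m : ℕ) : Submodule K (Polynomial K) :=
  (Polynomial.degreeLT K m).map (LinearMap.mulLeft K e)

theorem mem_mulDegreeLT {e : Polynomial K} {m : ℕ} {f : Polynomial K} :
    f ∈ mulDegreeLT e m ↔ ∃ s ∈ Polynomial.degreeLT K m, f = e * s := by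
  simp [mulDegreeLT, eq_comm]

theorem finrank_mulDegreeLT {e : Polynomial K} (he : e ≠ 0) (m : ℕ) :
    Module.finrank K (mulDegreeLT e m) = m := by
  rw [mulDegreeLT, finrank_map_of_injective _ fun x y h => mul_left_cancel₀ he h,
    finrank_degreeLT]

theorem finiteDimensional_mulDegreeLT (e : Polynomial K) (m : ℕ) :
    FiniteDimensional K (mulDegreeLT e m) := by
  have := finiteDimensional_degreeLT (K := K) m
  rw [mulDegreeLT]
  infer_instance

theorem two_mul_finrank_homogeneousSubmodule (k : ℕ) :
    2 * Module.finrank K (homogeneousSubmodule (Fin 3) K k) = (k + 1) * (k + 2) := by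
  let F : LineFrame K := ⟨1, 0, 0, 0, -1, 0, 0, by simp, by simp⟩
  have hfin := fun k => finiteDimensional_homogeneousSubmodule (K := K) k
  have hmap : ∀ k, (homogeneousSubmodule (Fin 3) K k).map F.res.toLinearMap =
      Polynomial.degreeLT K (k + 1) := by
    intro k
    ext s
    rw [Submodule.mem_map]
    constructor
    · rintro ⟨f, hf, rfl⟩
      refine Polynomial.mem_degreeLT.mpr (lt_of_le_of_lt Polynomial.degree_le_natDegree ?_)
      have := F.natDegree_res_le hf
      exact_mod_cast Nat.lt_succ_of_le this
    · intro hs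
      exact ⟨F.lift k s, F.lift_isHomogeneous k s, F.res_lift (natDegree_le_of_mem_degreeLT hs)⟩
  have hrank := fun k => finrank_map_add_finrank_inf_ker (homogeneousSubmodule (Fin 3) K k)
    F.res.toLinearMap
  induction k with
  | zero =>
    have hker : homogeneousSubmodule (Fin 3) K 0 ⊓ LinearMap.ker F.res.toLinearMap = ⊥ := by
      rw [eq_bot_iff]
      rintro f ⟨hf, hf0⟩
      obtain ⟨g, rfl⟩ := (F.form_dvd_iff hf).mpr hf0
      rw [Submodule.mem_bot, eq_zero_of_linear_mul F.form_isHomogeneous F.form_ne_zero hf,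
        mul_zero]
    have := hrank 0
    rw [hmap, hker, finrank_degreeLT, finrank_bot] at this
    omega
  | succ k ih =>
    have hker : homogeneousSubmodule (Fin 3) K (k + 1) ⊓ LinearMap.ker F.res.toLinearMap =
        (homogeneousSubmodule (Fin 3) K k).map (LinearMap.mulLeft K F.form) := by
      ext f
      constructor
      · rintro ⟨hf, hf0⟩
        obtain ⟨g, rfl⟩ := (F.form_dvd_iff hf).mpr hf0
        exact ⟨g, isHomogeneous_of_linear_mul F.form_isHomogeneous F.form_ne_zero hf, rfl⟩
      · rintro ⟨g, hg, rfl⟩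
        refine ⟨?_, F.res_eq_zero_of_dvd (dvd_mul_right _ _)⟩
        rw [add_comm]
        exact F.form_isHomogeneous.mul hg
    have := hrank (k + 1)
    rw [hmap, hker, finrank_degreeLT, finrank_map_of_injective _ fun x y h =>
      mul_left_cancel₀ F.form_ne_zero h] at this
    nlinarith

theorem finrank_logDerDeg_empty (k : ℕ) :
    Module.finrank K (logDerDeg (∅ : Finset (Set (K × K))) k) = (k + 1) * (k + 2) := by
  have h : logDerDeg (∅ : Finset (Set (K × K))) k =
      (homogeneousSubmodule (Fin 3) K k).prod (homogeneousSubmodule (Fin 3) K k) := by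
    refine inf_eq_right.mpr fun θ _ => ?_
    simp [mem_logDer]
  have := finiteDimensional_homogeneousSubmodule (K := K) k
  rw [h, ← (prodSubmoduleEquiv _ _).finrank_eq, Module.finrank_prod,
    ← two_mul_finrank_homogeneousSubmodule (K := K) k]
  ring

theorem resT_form_smul (F : LineFrame K)
    (η : MvPolynomial (Fin 3) K × MvPolynomial (Fin 3) K) : F.resT (F.form • η) = 0 := by
  rw [F.resT_apply, map_smul, smul_eq_mul, map_mul, F.res_form_self, zero_mul]

theorem map_resA_le {A : Finset (Set (K × K))} (hA : IsLineArr A) (H : Set (K × K)) (k : ℕ) :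
    (logDerDeg A k).map (frame H).resA ≤
      mulDegreeLT (excess A H) (k + 1 + (pts A H).card - A.card) := by
  rintro _ ⟨θ, hθ, rfl⟩
  exact mem_mulDegreeLT.mpr (exists_res_evA_eq hA hθ)

theorem finrank_map_resA_le {A : Finset (Set (K × K))} (hA : IsLineArr A) (H : Set (K × K))
    (k : ℕ) : Module.finrank K ((logDerDeg A k).map (frame H).resA) ≤
      k + 1 + (pts A H).card - A.card := by
  have := finiteDimensional_mulDegreeLT (excess A H) (k + 1 + (pts A H).card - A.card)
  exact (Submodule.finrank_mono (map_resA_le hA H k)).trans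
    (finrank_mulDegreeLT (excess_monic A H).ne_zero _).le

theorem map_resA_eq {A : Finset (Set (K × K))} (hA : IsLineArr A) {H : Set (K × K)}
    (hH : IsAffineLine H) (hHA : H ∉ A) {k : ℕ} (hk : A.card ≤ k) :
    (logDerDeg A k).map (frame H).resA =
      mulDegreeLT (excess A H) (k + 1 + (pts A H).card - A.card) := by
  refine le_antisymm (map_resA_le hA H k) fun f hf => ?_
  obtain ⟨s, hs, rfl⟩ := mem_mulDegreeLT.mp hf
  exact excess_mul_mem_map_resA hA hH hHA hk hs

section Insert

variable [DecidableEq (Set (K × K))]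

theorem crossers_insert (A : Finset (Set (K × K))) (H : Set (K × K)) :
    crossers (insert H A) H = crossers A H := by
  ext L
  simp only [mem_crossers, Finset.mem_insert]
  constructor
  · rintro ⟨rfl | h, h'⟩
    · exact absurd (LineFrame.slope_self _) h'
    · exact ⟨h, h'⟩
  · rintro ⟨h, h'⟩
    exact ⟨Or.inr h, h'⟩

theorem pts_insert (A : Finset (Set (K × K))) (H : Set (K × K)) :
    pts (insert H A) H = pts A H := by
  rw [pts, crossers_insert, pts]

theorem logDerDeg_inf_ker_resA (A : Finset (Set (K × K))) (H : Set (K × K)) (k : ℕ) :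
    logDerDeg A k ⊓ LinearMap.ker (frame H).resA = logDerDeg (insert H A) k := by
  ext θ
  rw [Submodule.mem_inf, LinearMap.mem_ker, LineFrame.resA_apply, mem_logDerDeg, mem_logDerDeg,
    mem_logDer, mem_logDer, Finset.forall_mem_insert]
  constructor
  · rintro ⟨⟨h, h1, h2⟩, h0⟩
    exact ⟨⟨(LineFrame.form_dvd_iff _ ((frame H).evA_isHomogeneous h1 h2)).mpr h0, h⟩, h1, h2⟩
  · rintro ⟨⟨h0, h⟩, h1, h2⟩
    exact ⟨⟨h, h1, h2⟩, (frame H).res_eq_zero_of_dvd h0⟩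

theorem exists_eq_form_smul {A : Finset (Set (K × K))} (hA : IsLineArr A) {H : Set (K × K)}
    (hH : IsAffineLine H) (hHA : H ∉ A) {k : ℕ}
    {θ : MvPolynomial (Fin 3) K × MvPolynomial (Fin 3) K} (hθ : θ ∈ logDerDeg (insert H A) k)
    (h0 : (frame H).resT θ = 0) :
    θ = 0 ∨ ∃ j, k = j + 1 ∧ ∃ η ∈ logDerDeg A j, θ = (frame H).form • η := by
  obtain ⟨hD, h1, h2⟩ := mem_logDerDeg.mp hθ
  set F := frame H with hF
  obtain ⟨e, he⟩ := hD H (Finset.mem_insert_self _ _)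
  obtain ⟨t, ht⟩ := (F.form_dvd_iff (F.evT_isHomogeneous h1 h2)).mpr h0
  have hθ' : θ = F.form • F.ofEv e t := by
    refine F.ext_ev ?_ ?_
    · rw [he, map_smul, F.evA_ofEv, smul_eq_mul]
    · rw [ht, map_smul, F.evT_ofEv, smul_eq_mul]
  have hhe := F.evA_isHomogeneous h1 h2
  have hht := F.evT_isHomogeneous h1 h2
  rw [he] at hhe
  rw [ht] at hht
  cases k with
  | zero =>
    left
    rw [hθ', eq_zero_of_linear_mul F.form_isHomogeneous F.form_ne_zero hhe,
      eq_zero_of_linear_mul F.form_isHomogeneous F.form_ne_zero hht]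
    simp [LineFrame.ofEv]
  | succ j =>
    refine Or.inr ⟨j, rfl, F.ofEv e t, ?_, hθ'⟩
    have h12 := F.ofEv_isHomogeneous
      (isHomogeneous_of_linear_mul F.form_isHomogeneous F.form_ne_zero hhe)
      (isHomogeneous_of_linear_mul F.form_isHomogeneous F.form_ne_zero hht)
    refine mem_logDerDeg.mpr ⟨fun L hL => ?_, h12⟩
    rw [LineFrame.form_dvd_iff _ ((frame L).evA_isHomogeneous h12.1 h12.2)]
    have := (frame L).res_eq_zero_of_dvd (hD L (Finset.mem_insert_of_mem hL))
    rw [hθ', map_smul, smul_eq_mul, map_mul] at this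
    refine (mul_eq_zero.mp this).resolve_left (LineFrame.res_form_ne_zero _ _ ?_)
    refine frame_line_ne hH (hA L hL) ?_
    rintro rfl
    exact hHA hL

theorem form_smul_mem {A : Finset (Set (K × K))} (H : Set (K × K)) {j : ℕ}
    {η : MvPolynomial (Fin 3) K × MvPolynomial (Fin 3) K} (hη : η ∈ logDerDeg A j) :
    (frame H).form • η ∈ logDerDeg (insert H A) (j + 1) := by
  have h := mem_logDerDeg.mp (smul_mem_logDerDeg (add_comm 1 j) (frame H).form_isHomogeneous hη)
  refine mem_logDerDeg.mpr ⟨?_, h.2⟩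
  rw [mem_logDer, Finset.forall_mem_insert]
  refine ⟨?_, h.1⟩
  rw [map_smul, smul_eq_mul]
  exact dvd_mul_right _ _

theorem map_resT_le (A : Finset (Set (K × K))) (H : Set (K × K)) (k : ℕ) :
    (logDerDeg (insert H A) k).map (frame H).resT ≤
      mulDegreeLT (Lagrange.nodal (pts A H) id) (k + 1 - (pts A H).card) := by
  rintro _ ⟨θ, hθ, rfl⟩
  have := exists_res_evT_eq (Finset.mem_insert_self H A) hθ
  rw [pts_insert] at this
  exact mem_mulDegreeLT.mpr this

theorem finrank_map_resA_add (A : Finset (Set (K × K))) (H : Set (K × K)) (k : ℕ) :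
    Module.finrank K ((logDerDeg A k).map (frame H).resA) +
      Module.finrank K (logDerDeg (insert H A) k) = Module.finrank K (logDerDeg A k) := by
  have := finiteDimensional_logDerDeg A k
  rw [← logDerDeg_inf_ker_resA]
  exact finrank_map_add_finrank_inf_ker _ _

theorem finrank_map_resT_add {A : Finset (Set (K × K))} (hA : IsLineArr A) {H : Set (K × K)}
    (hH : IsAffineLine H) (hHA : H ∉ A) (k : ℕ) :
    Module.finrank K ((logDerDeg (insert H A) (k + 1)).map (frame H).resT) +
      Module.finrank K (logDerDeg A k) = Module.finrank K (logDerDeg (insert H A) (k + 1)) := by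
  have := finiteDimensional_logDerDeg (insert H A) (k + 1)
  rw [← finrank_map_add_finrank_inf_ker (logDerDeg (insert H A) (k + 1)) (frame H).resT]
  congr 1
  have h : logDerDeg (insert H A) (k + 1) ⊓ LinearMap.ker (frame H).resT =
      (logDerDeg A k).map ((LinearMap.lsmul (MvPolynomial (Fin 3) K) _
        (frame H).form).restrictScalars K) := by
    ext θ
    constructor
    · rintro ⟨hθ, h0⟩
      rcases exists_eq_form_smul hA hH hHA hθ h0 with rfl | ⟨j, hj, η, hη, rfl⟩
      · exact zero_mem _
      · obtain rfl : k = j := by omega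
        exact ⟨η, hη, rfl⟩
    · rintro ⟨η, hη, rfl⟩
      exact ⟨form_smul_mem H hη, resT_form_smul _ _⟩
  rw [h, finrank_map_of_injective]
  intro x y hxy
  exact smul_right_injective _ (frame H).form_ne_zero hxy

theorem finrank_map_resT_zero {A : Finset (Set (K × K))} (hA : IsLineArr A) {H : Set (K × K)}
    (hH : IsAffineLine H) (hHA : H ∉ A) :
    Module.finrank K ((logDerDeg (insert H A) 0).map (frame H).resT) =
      Module.finrank K (logDerDeg (insert H A) 0) := by
  have := finiteDimensional_logDerDeg (insert H A) 0
  rw [← finrank_map_add_finrank_inf_ker (logDerDeg (insert H A) 0) (frame H).resT,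
    left_eq_add]
  have h : logDerDeg (insert H A) 0 ⊓ LinearMap.ker (frame H).resT = ⊥ := by
    rw [eq_bot_iff]
    rintro θ ⟨hθ, h0⟩
    rcases exists_eq_form_smul hA hH hHA hθ h0 with rfl | ⟨j, hj, _⟩
    · exact zero_mem _
    · omega
  rw [h, finrank_bot]

theorem finrank_map_resT_le (A : Finset (Set (K × K))) (H : Set (K × K)) (k : ℕ) :
    Module.finrank K ((logDerDeg (insert H A) k).map (frame H).resT) ≤
      k + 1 - (pts A H).card := by
  have := finiteDimensional_mulDegreeLT (Lagrange.nodal (pts A H) (id : K → K))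
    (k + 1 - (pts A H).card)
  exact (Submodule.finrank_mono (map_resT_le A H k)).trans
    (finrank_mulDegreeLT Lagrange.nodal_ne_zero _).le

end Insert

theorem mem_linesAt_iff {A : Finset (Set (K × K))} (hA : IsLineArr A) {H : Set (K × K)}
    (hH : IsAffineLine H) (hHA : H ∉ A) {L : Set (K × K)} {t : K} :
    L ∈ linesAt A H t ↔ L ∈ A ∧ (frame H).point t ∈ L := by
  rw [mem_linesAt]
  refine and_congr_right fun hL => ?_
  have hpt := (frame H).point_mem_iff (frame L) t
  rw [frame_line (hA L hL)] at hpt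
  rw [hpt]
  constructor
  · rintro ⟨hs, rfl⟩
    rw [LineFrame.root, mul_div_cancel₀ _ hs, neg_add_cancel]
  · intro h
    have hs : (frame H).slope (frame L) ≠ 0 := by
      intro hs
      rw [hs, zero_mul, zero_add] at h
      have := (frame H).line_eq_of (frame L) hs h
      rw [frame_line hH, frame_line (hA L hL)] at this
      exact hHA (this ▸ hL)
    refine ⟨hs, ?_⟩
    rw [LineFrame.root, div_eq_iff hs]
    linear_combination -h

theorem b2_insert [DecidableEq (Set (K × K))] {A : Finset (Set (K × K))} (hA : IsLineArr A)
    {H : Set (K × K)} (hH : IsAffineLine H) (hHA : H ∉ A) :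
    b2 (insert H A) = b2 A + (pts A H).card := by
  classical
  have hset : A.powerset.filter (fun B => 2 ≤ (insert H B).card ∧
      (⋂ L ∈ insert H B, (L : Set (K × K))).Nonempty) =
      (pts A H).biUnion fun t => (linesAt A H t).powerset.erase ∅ := by
    ext B
    simp only [Finset.mem_filter, Finset.mem_powerset, Finset.mem_biUnion, Finset.mem_erase]
    constructor
    · rintro ⟨hBA, hcard, x, hx⟩
      rw [Finset.card_insert_of_notMem fun h => hHA (hBA h)] at hcard
      have hB : B.Nonempty := Finset.card_pos.mp (by omega)
      rw [Set.mem_iInter₂] at hx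
      have hxH := hx H (Finset.mem_insert_self _ _)
      rw [← frame_line hH] at hxH
      obtain ⟨t, rfl⟩ := (frame H).exists_point_eq hxH
      have hsub : B ⊆ linesAt A H t := fun L hL =>
        (mem_linesAt_iff hA hH hHA).mpr ⟨hBA hL, hx L (Finset.mem_insert_of_mem hL)⟩
      exact ⟨t, mem_pts.mpr (hB.mono hsub), hB.ne_empty, hsub⟩
    · rintro ⟨t, -, hB, hsub⟩
      have hBA : B ⊆ A := fun L hL => (mem_linesAt.mp (hsub hL)).1
      refine ⟨hBA, ?_, (frame H).point t, Set.mem_iInter₂.mpr fun L hL => ?_⟩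
      · rw [Finset.card_insert_of_notMem fun h => hHA (hBA h)]
        have := Finset.card_pos.mpr (Finset.nonempty_iff_ne_empty.mpr hB)
        omega
      · rcases Finset.mem_insert.mp hL with rfl | hL
        · have := (frame L).point_mem t
          rwa [frame_line hH] at this
        · exact ((mem_linesAt_iff hA hH hHA).mp (hsub hL)).2
  rw [b2, Finset.sum_filter, Finset.sum_powerset_insert hHA, ← Finset.sum_filter, b2,
    ← Finset.sum_filter, hset, Finset.sum_biUnion]
  · congr 1
    rw [Finset.card_eq_sum_ones, Nat.cast_sum]
    refine Finset.sum_congr rfl fun t ht => ?_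
    have h := Finset.sum_powerset_neg_one_pow_card_of_nonempty (mem_pts.mp ht)
    rw [← Finset.add_sum_erase _ _ (Finset.empty_mem_powerset _)] at h
    rw [Finset.sum_congr rfl (g := fun B : Finset (Set (K × K)) => -(-1 : ℤ) ^ B.card),
      Finset.sum_neg_distrib]
    · simp only [Finset.card_empty, pow_zero] at h
      push_cast
      linear_combination -h
    · intro B hB
      rw [Finset.card_insert_of_notMem, pow_succ, mul_neg_one]
      intro h
      exact hHA (mem_linesAt.mp (Finset.mem_powerset.mp (Finset.mem_of_mem_erase hB) h)).1
  · intro t _ t' _ htt'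
    rw [Function.onFun, Finset.disjoint_left]
    intro B hB hB'
    obtain ⟨hne, hB⟩ := Finset.mem_erase.mp hB
    obtain ⟨L, hL⟩ := Finset.nonempty_iff_ne_empty.mpr hne
    have h1 := (mem_linesAt.mp (Finset.mem_powerset.mp hB hL)).2.2
    have h2 := (mem_linesAt.mp (Finset.mem_powerset.mp (Finset.mem_of_mem_erase hB') hL)).2.2
    exact htt' (h1.symm.trans h2)

theorem b2_empty {R : Type*} : b2 (∅ : Finset (Set (R × R))) = 0 := by
  classical
  refine Finset.sum_eq_zero fun B hB => ?_
  rw [Finset.powerset_empty, Finset.mem_filter, Finset.mem_singleton] at hB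
  obtain ⟨rfl, h, -⟩ := hB
  simp at h

theorem IsLineArr.mono {A B : Finset (Set (K × K))} (hA : IsLineArr A) (h : B ⊆ A) :
    IsLineArr B := fun L hL => hA L (h hL)

/-- The Hilbert function of the logarithmic derivations in large degrees. -/
theorem two_mul_finrank_logDerDeg {A : Finset (Set (K × K))} (hA : IsLineArr A) {k : ℕ}
    (hk : A.card ≤ k) :
    (2 * Module.finrank K (logDerDeg A k) : ℤ) =
      2 * (k + 1) * (k + 2) - 2 * A.card * (k + 1) + A.card * (A.card - 1) - 2 * b2 A := by
  classical
  induction A using Finset.induction_on with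
  | empty =>
    rw [finrank_logDerDeg_empty, b2_empty]
    push_cast [Finset.card_empty]
    ring
  | insert H A hHA ih =>
    have hA' : IsLineArr A := hA.mono (Finset.subset_insert _ _)
    have hH : IsAffineLine H := hA H (Finset.mem_insert_self _ _)
    rw [Finset.card_insert_of_notMem hHA] at hk ⊢
    have h := finrank_map_resA_add A H k
    rw [map_resA_eq hA' hH hHA (by omega), finrank_mulDegreeLT (excess_monic A H).ne_zero] at h
    have h' : (k + 1 + (pts A H).card - A.card : ℤ) + Module.finrank K (logDerDeg (insert H A) k) =
        Module.finrank K (logDerDeg A k) := by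
      rw [← h]
      push_cast [Nat.cast_sub (show A.card ≤ k + 1 + (pts A H).card by omega)]
      ring
    rw [b2_insert hA' hH hHA]
    have := ih hA' (by omega)
    push_cast
    linear_combination this + 2 * h'

/-- A homogeneous basis of `logDer A` of degrees `d₁` and `d₂`. -/
structure IsLogBasis (A : Finset (Set (K × K))) (d₁ d₂ : ℕ)
    (θ₁ θ₂ : MvPolynomial (Fin 3) K × MvPolynomial (Fin 3) K) : Prop where
  mem₁ : θ₁ ∈ logDerDeg A d₁
  mem₂ : θ₂ ∈ logDerDeg A d₂
  eq_zero : ∀ c₁ c₂ : MvPolynomial (Fin 3) K, c₁ • θ₁ + c₂ • θ₂ = 0 → c₁ = 0 ∧ c₂ = 0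
  exists_eq : ∀ θ ∈ logDer A, ∃ c₁ c₂ : MvPolynomial (Fin 3) K, θ = c₁ • θ₁ + c₂ • θ₂

theorem IsLogBasis.symm {A : Finset (Set (K × K))} {d₁ d₂ : ℕ}
    {θ₁ θ₂ : MvPolynomial (Fin 3) K × MvPolynomial (Fin 3) K} (h : IsLogBasis A d₁ d₂ θ₁ θ₂) :
    IsLogBasis A d₂ d₁ θ₂ θ₁ where
  mem₁ := h.mem₂
  mem₂ := h.mem₁
  eq_zero c₁ c₂ hc := (h.eq_zero c₂ c₁ (by rw [add_comm, hc])).symm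
  exists_eq θ hθ := by
    obtain ⟨c₁, c₂, h⟩ := h.exists_eq θ hθ
    exact ⟨c₂, c₁, by rw [add_comm, h]⟩

namespace LineFrame

theorem coeff_ne (F : LineFrame K) : (F.a, F.b) ≠ (0, 0) := by
  intro h
  obtain ⟨ha, hb⟩ := Prod.mk.inj h
  have := F.det
  rw [ha, hb] at this
  simp at this

theorem form_dvd_evA_of_line_eq {F G : LineFrame K} (h : G.line = F.line)
    {θ : MvPolynomial (Fin 3) K × MvPolynomial (Fin 3) K} (hF : F.form ∣ F.evA θ) :
    G.form ∣ G.evA θ := by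
  have h0 := (F.point_mem_iff G 0).mp (h ▸ F.point_mem 0)
  have h1 := (F.point_mem_iff G 1).mp (h ▸ F.point_mem 1)
  have hoff : F.offset G = 0 := by linear_combination h0
  have hs : F.slope G = 0 := by linear_combination h1 - h0
  rw [F.form_eq G, F.evA_eq G, hoff, hs]
  simpa using mul_dvd_mul_left (C (F.cross G)) hF

end LineFrame

/-- The coefficient vector of a derivation annihilating `z`. -/
noncomputable def extendZero (θ : MvPolynomial (Fin 3) K × MvPolynomial (Fin 3) K) :
    Fin 3 → MvPolynomial (Fin 3) K := ![θ.1, θ.2, 0]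

theorem applyDer3_lin3 (ψ : Fin 3 → MvPolynomial (Fin 3) K) (a b c : K) :
    applyDer3 ψ (lin3 a b c) = C a * ψ 0 + C b * ψ 1 + C c * ψ 2 := by
  simp [applyDer3, lin3, Fin.sum_univ_three, pderiv_X, Pi.single_apply]
  ring

theorem applyDer3_X (ψ : Fin 3 → MvPolynomial (Fin 3) K) (i : Fin 3) :
    applyDer3 ψ (X i) = ψ i := by
  simp [applyDer3, pderiv_X, Pi.single_apply]

theorem inDCone_iff {A : Finset (Set (K × K))} (hA : IsLineArr A)
    {ψ : Fin 3 → MvPolynomial (Fin 3) K} :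
    InDCone A ψ ↔ ∃ g, ∃ θ ∈ logDer A, ψ = fun j => g * X j + extendZero θ j := by
  constructor
  · rintro ⟨h, g, hg⟩
    rw [applyDer3_X] at hg
    refine ⟨g, (ψ 0 - g * X 0, ψ 1 - g * X 1), fun L hL => ?_, ?_⟩
    · obtain ⟨e, he⟩ := h L hL _ _ (frame L).c (frame L).coeff_ne (frame_line (hA L hL)).symm
      rw [applyDer3_lin3, hg] at he
      refine ⟨e - g, ?_⟩
      rw [LineFrame.evA_apply, LineFrame.form]
      rw [lin3] at he ⊢
      linear_combination he
    · ext1 j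
      fin_cases j
      · simp [extendZero]
      · simp [extendZero]
      · simp [extendZero, hg]
  · rintro ⟨g, θ, hθ, rfl⟩
    refine ⟨?_, g, by simp [applyDer3_X, extendZero]⟩
    intro L hL a b c hab hLeq
    obtain ⟨G, rfl, rfl, rfl⟩ := LineFrame.exists_coeff_eq c hab
    obtain ⟨e, he⟩ := LineFrame.form_dvd_evA_of_line_eq (F := frame L) (G := G)
      ((frame_line (hA L hL)).symm ▸ hLeq.symm) (hθ L hL)
    refine ⟨g + e, ?_⟩
    rw [LineFrame.evA_apply, LineFrame.form] at he
    rw [applyDer3_lin3]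
    simp only [extendZero, Matrix.cons_val_zero, Matrix.cons_val_one, Matrix.cons_val]
    rw [lin3] at he ⊢
    linear_combination he

theorem IsFreeExp.exists_isLogBasis {A : Finset (Set (K × K))} (hA : IsLineArr A) {d₁ d₂ : ℕ}
    (h : IsFreeExp A d₁ d₂) : ∃ θ₁ θ₂, IsLogBasis A d₁ d₂ θ₁ θ₂ := by
  obtain ⟨ψ₁, ψ₂, h₁, h₂, hh₁, hh₂, hbasis⟩ := h
  have key : ∀ (ψ : Fin 3 → MvPolynomial (Fin 3) K) (d : ℕ), InDCone A ψ → HomogDer3 ψ d →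
      ∃ g, ∃ θ ∈ logDerDeg A d, ψ = fun j => g * X j + extendZero θ j := by
    intro ψ d h hh
    obtain ⟨g, θ, hθ, rfl⟩ := (inDCone_iff hA).mp h
    refine ⟨g, θ, mem_logDerDeg.mpr ⟨hθ, ?_⟩, rfl⟩
    have h2 := hh 2
    simp only [extendZero, Matrix.cons_val, add_zero] at h2
    rw [mul_comm] at h2
    have hX : ∀ j, (g * X j).IsHomogeneous d := by
      intro j
      rw [mul_comm]
      exact isHomogeneous_linear_mul_of_linear_mul (isHomogeneous_X K 2) (X_ne_zero 2)
        (isHomogeneous_X K j) h2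
    constructor
    · have := (hh 0).sub (hX 0)
      simpa [extendZero] using this
    · have := (hh 1).sub (hX 1)
      simpa [extendZero] using this
  obtain ⟨g₁, θ₁, hθ₁, rfl⟩ := key ψ₁ d₁ h₁ hh₁
  obtain ⟨g₂, θ₂, hθ₂, rfl⟩ := key ψ₂ d₂ h₂ hh₂
  refine ⟨θ₁, θ₂, hθ₁, hθ₂, ?_, ?_⟩
  · intro c₁ c₂ hc
    have hc1 := congrArg Prod.fst hc
    have hc2 := congrArg Prod.snd hc
    simp only [Prod.fst_add, Prod.smul_fst, Prod.snd_add, Prod.smul_snd, smul_eq_mul,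
      Prod.fst_zero, Prod.snd_zero] at hc1 hc2
    obtain ⟨_, _, huniq⟩ := hbasis 0 ((inDCone_iff hA).mpr ⟨0, 0, zero_mem _, by
      ext1 j; fin_cases j <;> simp [extendZero]⟩)
    have e1 := huniq (-(c₁ * g₁ + c₂ * g₂), c₁, c₂) (by
      ext1 j
      fin_cases j
      · simp [extendZero]
        linear_combination -hc1
      · simp [extendZero]
        linear_combination -hc2
      · simp [extendZero]
        ring)
    have e2 := huniq (0, 0, 0) (by
      ext1 j
      simp)
    have := e1.trans e2.symm
    simp only [Prod.mk.injEq] at this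
    exact this.2
  · intro θ hθ
    obtain ⟨⟨c₀, c₁, c₂⟩, hc, -⟩ := hbasis (extendZero θ) ((inDCone_iff hA).mpr ⟨0, θ, hθ, by
      ext1 j; simp⟩)
    have h2 := congrFun hc 2
    simp only [extendZero, Matrix.cons_val, add_zero] at h2
    have hz : c₀ + c₁ * g₁ + c₂ * g₂ = 0 := by
      have : (c₀ + c₁ * g₁ + c₂ * g₂) * (X 2 : MvPolynomial (Fin 3) K) = 0 := by
        linear_combination -h2
      exact (mul_eq_zero.mp this).resolve_right (X_ne_zero 2)
    refine ⟨c₁, c₂, Prod.ext ?_ ?_⟩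
    · have := congrFun hc 0
      simp only [extendZero, Matrix.cons_val_zero] at this
      simp only [Prod.fst_add, Prod.smul_fst, smul_eq_mul]
      linear_combination this + X 0 * hz
    · have := congrFun hc 1
      simp only [extendZero, Matrix.cons_val_one, Matrix.cons_val_zero] at this
      simp only [Prod.snd_add, Prod.smul_snd, smul_eq_mul]
      linear_combination this + X 1 * hz

theorem IsLogBasis.isFreeExp {A : Finset (Set (K × K))} (hA : IsLineArr A) {d₁ d₂ : ℕ}
    {θ₁ θ₂ : MvPolynomial (Fin 3) K × MvPolynomial (Fin 3) K} (h : IsLogBasis A d₁ d₂ θ₁ θ₂) :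
    IsFreeExp A d₁ d₂ := by
  have key : ∀ (θ : MvPolynomial (Fin 3) K × MvPolynomial (Fin 3) K) (d : ℕ), θ ∈ logDerDeg A d →
      InDCone A (extendZero θ) ∧ HomogDer3 (extendZero θ) d := by
    intro θ d hθ
    obtain ⟨hD, h1, h2⟩ := mem_logDerDeg.mp hθ
    refine ⟨(inDCone_iff hA).mpr ⟨0, θ, hD, by ext1 j; simp⟩, fun j => ?_⟩
    fin_cases j
    · exact h1
    · exact h2
    · exact isHomogeneous_zero _ _ _
  refine ⟨extendZero θ₁, extendZero θ₂, (key θ₁ d₁ h.mem₁).1, (key θ₂ d₂ h.mem₂).1,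
    (key θ₁ d₁ h.mem₁).2, (key θ₂ d₂ h.mem₂).2, fun ψ hψ => ?_⟩
  obtain ⟨g, θ, hθ, rfl⟩ := (inDCone_iff hA).mp hψ
  obtain ⟨c₁, c₂, rfl⟩ := h.exists_eq θ hθ
  refine ⟨(g, c₁, c₂), ?_, ?_⟩
  · ext1 j
    fin_cases j <;> simp [extendZero, add_assoc]
  · rintro ⟨g', c₁', c₂'⟩ hc
    have h0 := congrFun hc 0
    have h1 := congrFun hc 1
    have h2 := congrFun hc 2
    simp only [extendZero, Matrix.cons_val_zero, Matrix.cons_val_one, Matrix.cons_val,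
      Prod.fst_add, Prod.snd_add, Prod.smul_fst, Prod.smul_snd, smul_eq_mul, mul_zero,
      add_zero] at h0 h1 h2
    have hg : g = g' := mul_right_cancel₀ (X_ne_zero 2) h2
    subst hg
    obtain ⟨e1, e2⟩ := h.eq_zero (c₁' - c₁) (c₂' - c₂) (Prod.ext
      (by
        simp only [Prod.fst_add, Prod.smul_fst, smul_eq_mul, Prod.fst_zero]
        linear_combination -h0)
      (by
        simp only [Prod.snd_add, Prod.smul_snd, smul_eq_mul, Prod.snd_zero]
        linear_combination -h1))
    rw [sub_eq_zero.mp e1, sub_eq_zero.mp e2]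

theorem finrank_logDerDeg_of_isLogBasis {A : Finset (Set (K × K))} {d₁ d₂ : ℕ}
    {θ₁ θ₂ : MvPolynomial (Fin 3) K × MvPolynomial (Fin 3) K} (h : IsLogBasis A d₁ d₂ θ₁ θ₂)
    {k i j : ℕ} (hi : d₁ + i = k) (hj : d₂ + j = k) :
    Module.finrank K (logDerDeg A k) = Module.finrank K (homogeneousSubmodule (Fin 3) K i) +
      Module.finrank K (homogeneousSubmodule (Fin 3) K j) := by
  have hfi := finiteDimensional_homogeneousSubmodule (K := K) i
  have hfj := finiteDimensional_homogeneousSubmodule (K := K) j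
  let Φ : MvPolynomial (Fin 3) K × MvPolynomial (Fin 3) K →ₗ[K]
      MvPolynomial (Fin 3) K × MvPolynomial (Fin 3) K :=
    ((LinearMap.toSpanSingleton (MvPolynomial (Fin 3) K) _ θ₁).coprod
      (LinearMap.toSpanSingleton (MvPolynomial (Fin 3) K) _ θ₂)).restrictScalars K
  have hΦ : ∀ c, Φ c = c.1 • θ₁ + c.2 • θ₂ := fun c => rfl
  have hinj : Function.Injective Φ := by
    rw [← LinearMap.ker_eq_bot, eq_bot_iff]
    intro c hc
    rw [LinearMap.mem_ker, hΦ] at hc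
    obtain ⟨h1, h2⟩ := h.eq_zero _ _ hc
    exact Prod.ext h1 h2
  have hmap : ((homogeneousSubmodule (Fin 3) K i).prod (homogeneousSubmodule (Fin 3) K j)).map Φ =
      logDerDeg A k := by
    ext θ
    constructor
    · rintro ⟨c, ⟨h1, h2⟩, rfl⟩
      rw [hΦ]
      exact add_mem (smul_mem_logDerDeg (by omega) h1 h.mem₁)
        (smul_mem_logDerDeg (by omega) h2 h.mem₂)
    · intro hθ
      obtain ⟨hD, hk1, hk2⟩ := mem_logDerDeg.mp hθ
      obtain ⟨c₁, c₂, rfl⟩ := h.exists_eq θ hD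
      refine ⟨(homogeneousComponent i c₁, homogeneousComponent j c₂),
        ⟨homogeneousComponent_isHomogeneous _ _, homogeneousComponent_isHomogeneous _ _⟩, ?_⟩
      rw [hΦ]
      have key : ∀ {f g : MvPolynomial (Fin 3) K}, f.IsHomogeneous d₁ → g.IsHomogeneous d₂ →
          (c₁ * f + c₂ * g).IsHomogeneous k →
          homogeneousComponent i c₁ * f + homogeneousComponent j c₂ * g = c₁ * f + c₂ * g := by
        intro f g hf hg hfg
        have e₁ : homogeneousComponent k (f * c₁) = f * homogeneousComponent i c₁ := by
          rw [← hi]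
          exact homogeneousComponent_mul_of_isHomogeneous hf _ _
        have e₂ : homogeneousComponent k (g * c₂) = g * homogeneousComponent j c₂ := by
          rw [← hj]
          exact homogeneousComponent_mul_of_isHomogeneous hg _ _
        rw [← homogeneousComponent_eq_self hfg, map_add, mul_comm c₁, mul_comm c₂, e₁, e₂]
        ring
      exact Prod.ext (key h.mem₁.2.1 h.mem₂.2.1 hk1) (key h.mem₁.2.2 h.mem₂.2.2 hk2)
  rw [← hmap, finrank_map_of_injective _ hinj, ← (prodSubmoduleEquiv _ _).finrank_eq,
    Module.finrank_prod]

/-- The exponents of a free arrangement are the roots of its characteristic polynomial. -/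
theorem IsLogBasis.add_eq_and_mul_eq {A : Finset (Set (K × K))} (hA : IsLineArr A) {d₁ d₂ : ℕ}
    {θ₁ θ₂ : MvPolynomial (Fin 3) K × MvPolynomial (Fin 3) K} (h : IsLogBasis A d₁ d₂ θ₁ θ₂) :
    d₁ + d₂ = A.card ∧ (d₁ * d₂ : ℤ) = b2 A := by
  have key : ∀ m : ℕ, ((m + d₂ + 1) * (m + d₂ + 2) + (m + d₁ + 1) * (m + d₁ + 2) : ℤ) =
      2 * (m + d₁ + d₂ + 1) * (m + d₁ + d₂ + 2) - 2 * A.card * (m + d₁ + d₂ + 1) +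
        A.card * (A.card - 1) - 2 * b2 A ∨ m < A.card := by
    intro m
    by_cases hm : m < A.card
    · exact Or.inr hm
    left
    have h1 := finrank_logDerDeg_of_isLogBasis h (k := m + d₁ + d₂) (i := m + d₂) (j := m + d₁)
      (by omega) (by omega)
    have h2 := two_mul_finrank_logDerDeg hA (k := m + d₁ + d₂) (by omega)
    have h3 := two_mul_finrank_homogeneousSubmodule (K := K) (m + d₁)
    have h4 := two_mul_finrank_homogeneousSubmodule (K := K) (m + d₂)
    rw [h1] at h2
    zify at h3 h4
    push_cast at h2
    linear_combination h2 - h3 - h4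
  have k1 := (key A.card).resolve_right (lt_irrefl _)
  have k2 := (key (A.card + 1)).resolve_right (by omega)
  push_cast at k1 k2
  have hsum : (d₁ + d₂ : ℤ) = A.card := by linarith
  refine ⟨by exact_mod_cast hsum, ?_⟩
  rw [← hsum] at k1
  linarith

theorem LineFrame.form_mul_ne_one (F : LineFrame K) {c : MvPolynomial (Fin 3) K} : F.form * c ≠ 1 := by
  intro h
  have := congrArg F.res h
  rw [map_mul, F.res_form_self, zero_mul, map_one] at this
  exact zero_ne_one this

theorem eq_zero_of_mem_degreeLT_zero {s : Polynomial K} (hs : s ∈ Polynomial.degreeLT K 0) :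
    s = 0 := by
  rw [Polynomial.mem_degreeLT, Nat.cast_zero] at hs
  exact Polynomial.degree_eq_bot.mp (Nat.WithBot.lt_zero_iff.mp hs)

section Insert

variable [DecidableEq (Set (K × K))]

theorem resT_eq_zero_of_lt {A : Finset (Set (K × K))} {H : Set (K × K)} {k : ℕ}
    {θ : MvPolynomial (Fin 3) K × MvPolynomial (Fin 3) K} (hθ : θ ∈ logDerDeg (insert H A) k)
    (hk : k < (pts A H).card) : (frame H).resT θ = 0 := by
  obtain ⟨s, hs, h⟩ := exists_res_evT_eq (Finset.mem_insert_self H A) hθ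
  rw [pts_insert, show k + 1 - (pts A H).card = 0 by omega] at hs
  rw [LineFrame.resT_apply, h, eq_zero_of_mem_degreeLT_zero hs, mul_zero]

theorem IsLogBasis.card_pts_eq {A : Finset (Set (K × K))} {H : Set (K × K)}
    (hA : IsLineArr A) (hH : IsAffineLine H) (hHA : H ∉ A) {d₁ d₂ : ℕ}
    {θ₁ θ₂ : MvPolynomial (Fin 3) K × MvPolynomial (Fin 3) K}
    (h : IsLogBasis (insert H A) d₁ d₂ θ₁ θ₂) (hcard : A.card + 1 = d₁ + d₂)
    (hlt : d₁ < (pts A H).card) : (pts A H).card = d₂ := by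
  have hdiv : ∀ {d d' θ θ'}, IsLogBasis (insert H A) d d' θ θ' → d < (pts A H).card →
      ∃ j, d = j + 1 ∧ ∃ η ∈ logDerDeg A j, θ = (frame H).form • η ∧
        (frame H).resA η ≠ 0 := by
    intro d d' θ θ' h hd
    rcases exists_eq_form_smul hA hH hHA h.mem₁ (resT_eq_zero_of_lt h.mem₁ hd) with
      h0 | ⟨j, hj, η, hη, rfl⟩
    · exact absurd (h.eq_zero 1 0 (by rw [h0]; simp)).1 one_ne_zero
    · refine ⟨j, hj, η, hη, rfl, fun h0 => ?_⟩
      have hη' : η ∈ logDerDeg (insert H A) j := by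
        rw [← logDerDeg_inf_ker_resA]
        exact ⟨hη, h0⟩
      obtain ⟨c₁, c₂, hc⟩ := h.exists_eq η hη'.1
      have := (h.eq_zero ((frame H).form * c₁ - 1) ((frame H).form * c₂) (by
        have h' := congrArg ((frame H).form • ·) hc
        simp only [smul_add] at h'
        rw [sub_smul, mul_smul, mul_smul, one_smul]
        rw [sub_add_eq_add_sub, ← h', sub_self])).1
      exact (frame H).form_mul_ne_one (sub_eq_zero.mp this)
  obtain ⟨j₁, hj₁, η₁, hη₁, rfl, hr₁⟩ := hdiv h hlt
  have hge : d₂ ≤ (pts A H).card := by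
    obtain ⟨s, hs, hres⟩ := exists_res_evA_eq hA (H := H) hη₁
    by_contra hcon
    rw [show j₁ + 1 + (pts A H).card - A.card = 0 by omega] at hs
    exact hr₁ (by rw [LineFrame.resA_apply, hres, eq_zero_of_mem_degreeLT_zero hs, mul_zero])
  refine le_antisymm ?_ hge
  by_contra! hcon
  obtain ⟨j₂, hj₂, η₂, hη₂, rfl, hr₂⟩ := hdiv h.symm hcon
  set F := frame H with hF
  have hmem : F.evA η₂ • η₁ - F.evA η₁ • η₂ ∈ logDer (insert H A) := by
    rw [mem_logDer, Finset.forall_mem_insert]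
    refine ⟨?_, (logDer A).sub_mem ((logDer A).smul_mem _ hη₁.1) ((logDer A).smul_mem _ hη₂.1)⟩
    rw [map_sub, map_smul, map_smul, smul_eq_mul, smul_eq_mul, mul_comm, sub_self]
    exact dvd_zero _
  obtain ⟨c₁, c₂, hc⟩ := h.exists_eq _ hmem
  have h' := congrArg (F.form • ·) hc
  simp only [smul_add, smul_sub] at h'
  have h0 := (h.eq_zero (F.form * c₁ - F.evA η₂) (F.form * c₂ + F.evA η₁) (by
    rw [sub_smul, add_smul, mul_smul, mul_smul]
    rw [smul_comm F.form (F.evA η₂), smul_comm F.form (F.evA η₁)] at h'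
    rw [← sub_eq_zero] at h'
    rw [← neg_eq_zero, ← h']
    abel)).2
  have := congrArg F.res h0
  rw [map_add, map_mul, F.res_form_self, zero_mul, zero_add, map_zero] at this
  exact hr₁ this

end Insert

theorem finrank_map_eq_of_mul_eq [DecidableEq (Set (K × K))] {A : Finset (Set (K × K))}
    {H : Set (K × K)}
    (hA : IsLineArr A) (hH : IsAffineLine H) (hHA : H ∉ A) {a b : ℕ} (ha : (pts A H).card = a)
    (ha1 : 1 ≤ a) (hsum : a + b = A.card + 1) (hmul : (a * b : ℤ) = b2 (insert H A)) (k : ℕ) :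
    Module.finrank K ((logDerDeg (insert H A) (k + 1)).map (frame H).resT) = k + 2 - a ∧
      Module.finrank K ((logDerDeg A k).map (frame H).resA) = k + 2 - b := by
  have hA' : IsLineArr (insert H A) := by
    intro L hL
    rcases Finset.mem_insert.mp hL with rfl | hL
    · exact hH
    · exact hA L hL
  have hcard : (insert H A).card = a + b := by rw [Finset.card_insert_of_notMem hHA, hsum]
  have htriangle : ∀ c k : ℕ,
      (k + 1 + 1 - c) * (k + 1 + 2 - c) = (k + 1 - c) * (k + 2 - c) + 2 * (k + 2 - c) := by
    intro c k
    rcases le_or_gt c (k + 1) with h | h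
    · obtain ⟨m, hm⟩ := Nat.exists_eq_add_of_le h
      rw [show k + 1 + 1 - c = m + 1 by omega, show k + 1 + 2 - c = m + 2 by omega,
        show k + 1 - c = m by omega]
      ring
    · rw [show k + 1 + 1 - c = 0 by omega, show k + 1 - c = 0 by omega]
      omega
  have hT : ∀ k, Module.finrank K ((logDerDeg (insert H A) (k + 1)).map (frame H).resT) ≤
      k + 2 - a := fun k => (finrank_map_resT_le A H (k + 1)).trans (by omega)
  have hR : ∀ k, Module.finrank K ((logDerDeg A k).map (frame H).resA) ≤ k + 2 - b :=
    fun k => (finrank_map_resA_le hA H k).trans (by omega)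
  obtain ⟨D, hD⟩ : ∃ D : ℕ → ℤ, ∀ k, D k = (((k + 1 - a) * (k + 2 - a) +
      (k + 1 - b) * (k + 2 - b) : ℕ) : ℤ) - 2 * Module.finrank K (logDerDeg (insert H A) k) :=
    ⟨_, fun _ => rfl⟩
  have hstep : ∀ k, D (k + 1) = D k +
      2 * (((k + 2 - a : ℕ) : ℤ) -
        Module.finrank K ((logDerDeg (insert H A) (k + 1)).map (frame H).resT)) +
      2 * (((k + 2 - b : ℕ) : ℤ) - Module.finrank K ((logDerDeg A k).map (frame H).resA)) := by
    intro k
    have h1 := finrank_map_resT_add hA hH hHA k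
    have h2 := finrank_map_resA_add A H k
    rw [hD, hD, htriangle a, htriangle b, ← h1, ← h2]
    push_cast
    ring
  have hmono : Monotone D := monotone_nat_of_le_succ fun k => by
    have := hT k
    have := hR k
    have := hstep k
    omega
  have hzero : 0 ≤ D 0 := by
    have h0 := finrank_map_resT_le A H 0
    rw [finrank_map_resT_zero hA hH hHA] at h0
    rw [hD, show Module.finrank K (logDerDeg (insert H A) 0) = 0 by omega]
    simp only [Nat.cast_zero, mul_zero, sub_zero]
    exact Int.natCast_nonneg _
  have hlast : D (k + 1 + a + b) = 0 := by
    have h := two_mul_finrank_logDerDeg hA' (k := k + 1 + a + b) (by omega)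
    rw [hcard, ← hmul] at h
    rw [hD, h, show k + 1 + a + b + 1 - a = k + b + 2 by omega,
      show k + 1 + a + b + 2 - a = k + b + 3 by omega,
      show k + 1 + a + b + 1 - b = k + a + 2 by omega,
      show k + 1 + a + b + 2 - b = k + a + 3 by omega]
    push_cast
    ring
  have h1 := hmono (Nat.zero_le k)
  have h2 := hmono (show k + 1 ≤ k + 1 + a + b by omega)
  have := hT k
  have := hR k
  have := hstep k
  omega

theorem exists_smul_mem_logDerDeg_res_eq (F : LineFrame K) {A : Finset (Set (K × K))} {a k : ℕ}
    {θ : MvPolynomial (Fin 3) K × MvPolynomial (Fin 3) K} (hθ : θ ∈ logDerDeg A a)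
    {s : Polynomial K} (hs : s ∈ Polynomial.degreeLT K (k + 1 - a)) :
    ∃ f : MvPolynomial (Fin 3) K, f • θ ∈ logDerDeg A k ∧ F.res f = s := by
  rcases le_or_gt a k with h | h
  · rw [show k + 1 - a = k - a + 1 by omega] at hs
    exact ⟨F.lift (k - a) s, smul_mem_logDerDeg (Nat.sub_add_cancel h)
      (F.lift_isHomogeneous _ _) hθ, F.res_lift (natDegree_le_of_mem_degreeLT hs)⟩
  · rw [show k + 1 - a = 0 by omega] at hs
    refine ⟨0, ?_, by rw [map_zero, eq_zero_of_mem_degreeLT_zero hs]⟩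
    rw [zero_smul]
    exact zero_mem _

theorem homogeneousComponent_mem_logDerDeg {A : Finset (Set (K × K))}
    {θ : MvPolynomial (Fin 3) K × MvPolynomial (Fin 3) K} (hθ : θ ∈ logDer A) (k : ℕ) :
    (homogeneousComponent k θ.1, homogeneousComponent k θ.2) ∈ logDerDeg A k := by
  refine mem_logDerDeg.mpr ⟨fun L hL => ?_, homogeneousComponent_isHomogeneous _ _,
    homogeneousComponent_isHomogeneous _ _⟩
  obtain ⟨g, hg⟩ := hθ L hL
  have h := congrArg (homogeneousComponent k) hg
  rw [LineFrame.evA_apply, map_add, homogeneousComponent_C_mul, homogeneousComponent_C_mul] at h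
  rw [LineFrame.evA_apply]
  dsimp only
  rw [h]
  cases k with
  | zero =>
    rw [homogeneousComponent_mul_of_lt (frame L).form_isHomogeneous _ one_pos]
    exact dvd_zero _
  | succ k =>
    rw [add_comm k 1, homogeneousComponent_mul_of_isHomogeneous (frame L).form_isHomogeneous]
    exact dvd_mul_right _ _

theorem sum_homogeneousComponent_prod (θ : MvPolynomial (Fin 3) K × MvPolynomial (Fin 3) K) :
    ∑ k ∈ Finset.range (θ.1.totalDegree + θ.2.totalDegree + 1),
      (homogeneousComponent k θ.1, homogeneousComponent k θ.2) = θ := by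
  have key : ∀ (f : MvPolynomial (Fin 3) K) {N : ℕ}, f.totalDegree + 1 ≤ N →
      ∑ k ∈ Finset.range N, homogeneousComponent k f = f := by
    intro f N hN
    rw [← Finset.sum_subset (Finset.range_mono hN), sum_homogeneousComponent]
    intro k _ hk
    exact homogeneousComponent_eq_zero _ _ (by simpa [Nat.lt_succ_iff] using hk)
  refine Prod.ext ?_ ?_
  · rw [Prod.fst_sum]
    exact key θ.1 (by omega)
  · rw [Prod.snd_sum]
    exact key θ.2 (by omega)

/-- A line arrangement whose second Betti number factors through the number of intersection
points on one of its lines is free. -/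
theorem exists_isLogBasis_of_mul_eq [DecidableEq (Set (K × K))] {A : Finset (Set (K × K))}
    {H : Set (K × K)}
    (hA : IsLineArr A) (hH : IsAffineLine H) (hHA : H ∉ A) {a b : ℕ} (ha : (pts A H).card = a)
    (ha1 : 1 ≤ a) (hb1 : 1 ≤ b) (hsum : a + b = A.card + 1)
    (hmul : (a * b : ℤ) = b2 (insert H A)) :
    ∃ θ₁ θ₂, IsLogBasis (insert H A) a b θ₁ θ₂ := by
  have hfin := finrank_map_eq_of_mul_eq hA hH hHA ha ha1 hsum hmul
  obtain ⟨θ, hθ, hTθ⟩ : ∃ θ ∈ logDerDeg (insert H A) a,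
      (frame H).resT θ = Lagrange.nodal (pts A H) id := by
    have hfd := finiteDimensional_mulDegreeLT (Lagrange.nodal (pts A H) (id : K → K))
      (a - 1 + 1 + 1 - (pts A H).card)
    have h := Submodule.eq_of_le_of_finrank_eq (map_resT_le A H (a - 1 + 1)) (by
      rw [(hfin (a - 1)).1, finrank_mulDegreeLT Lagrange.nodal_ne_zero]
      omega)
    have hmem : (Lagrange.nodal (pts A H) id : Polynomial K) ∈
        (logDerDeg (insert H A) (a - 1 + 1)).map (frame H).resT := by
      rw [h, mem_mulDegreeLT]
      refine ⟨1, ?_, (mul_one _).symm⟩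
      rw [Polynomial.mem_degreeLT, Polynomial.degree_one, Nat.cast_pos]
      omega
    rw [Nat.sub_add_cancel ha1] at hmem
    exact hmem
  obtain ⟨η, hη, hRη⟩ : ∃ η ∈ logDerDeg A (b - 1), (frame H).resA η = excess A H := by
    have hfd := finiteDimensional_mulDegreeLT (excess A H) (b - 1 + 1 + (pts A H).card - A.card)
    have h := Submodule.eq_of_le_of_finrank_eq (map_resA_le hA H (b - 1)) (by
      rw [(hfin (b - 1)).2, finrank_mulDegreeLT (excess_monic A H).ne_zero]
      omega)
    have hmem : excess A H ∈ (logDerDeg A (b - 1)).map (frame H).resA := by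
      rw [h, mem_mulDegreeLT]
      refine ⟨1, ?_, (mul_one _).symm⟩
      rw [Polynomial.mem_degreeLT, Polynomial.degree_one, Nat.cast_pos]
      omega
    exact hmem
  set F := frame H with hF
  have hmem₂ : F.form • η ∈ logDerDeg (insert H A) b := by
    have := form_smul_mem H hη
    rwa [Nat.sub_add_cancel hb1] at this
  have hgen : ∀ k, ∀ ζ ∈ logDerDeg (insert H A) k,
      ζ ∈ Submodule.span (MvPolynomial (Fin 3) K) {θ, F.form • η} := by
    intro k
    induction k using Nat.strong_induction_on with
    | _ k ih =>
      intro ζ hζ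
      obtain ⟨s, hs, hres⟩ := mem_mulDegreeLT.mp
        (map_resT_le A H k (Submodule.mem_map_of_mem hζ))
      rw [ha] at hs
      obtain ⟨f, hf, rfl⟩ := exists_smul_mem_logDerDeg_res_eq F hθ hs
      have hsub : F.resT (ζ - f • θ) = 0 := by
        rw [map_sub, hres, F.resT_apply (f • θ), map_smul, smul_eq_mul, map_mul, ← F.resT_apply,
          hTθ]
        ring
      have hfspan : f • θ ∈ Submodule.span (MvPolynomial (Fin 3) K) {θ, F.form • η} :=
        Submodule.smul_mem _ _ (Submodule.subset_span (by simp))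
      rw [← sub_add_cancel ζ (f • θ)]
      refine add_mem ?_ hfspan
      rcases exists_eq_form_smul hA hH hHA (sub_mem hζ hf) hsub with h0 | ⟨j, rfl, ξ, hξ, hξe⟩
      · rw [h0]
        exact zero_mem _
      rw [hξe]
      obtain ⟨s, hs, hres⟩ := mem_mulDegreeLT.mp
        (map_resA_le hA H j (Submodule.mem_map_of_mem hξ))
      rw [ha, show j + 1 + a - A.card = j + 1 - (b - 1) by omega] at hs
      obtain ⟨g, hg, rfl⟩ := exists_smul_mem_logDerDeg_res_eq F hη hs
      have hsub' : F.resA (ξ - g • η) = 0 := by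
        rw [map_sub, hres, F.resA_apply (g • η), map_smul, smul_eq_mul, map_mul, ← F.resA_apply,
          hRη]
        ring
      have hmem : ξ - g • η ∈ logDerDeg (insert H A) j := by
        rw [← logDerDeg_inf_ker_resA]
        exact ⟨sub_mem hξ hg, hsub'⟩
      rw [← sub_add_cancel ξ (g • η), smul_add, smul_comm]
      exact add_mem (Submodule.smul_mem _ _ (ih j (Nat.lt_succ_self j) _ hmem))
        (Submodule.smul_mem _ _ (Submodule.subset_span (Set.mem_insert_of_mem _ rfl)))
  refine ⟨θ, F.form • η, hθ, hmem₂, ?_, ?_⟩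
  · intro c₁ c₂ hc
    obtain ⟨e, he⟩ := hθ.1 H (Finset.mem_insert_self H A)
    rw [← hF] at he
    have h1 := congrArg F.evA hc
    have h2 := congrArg F.evT hc
    rw [map_add, map_smul, map_smul, map_smul, map_zero, smul_eq_mul, smul_eq_mul,
      smul_eq_mul] at h1 h2
    rw [he] at h1
    have h3 : c₁ * e + c₂ * F.evA η = 0 := by
      refine (mul_eq_zero.mp (?_ : F.form * (c₁ * e + c₂ * F.evA η) = 0)).resolve_left
        F.form_ne_zero
      linear_combination h1
    have hT0 : F.evT θ ≠ 0 := by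
      intro h0
      rw [F.resT_apply, h0, map_zero] at hTθ
      exact Lagrange.nodal_ne_zero hTθ.symm
    have h4 : c₂ * (F.form * F.evT η * e - F.evA η * F.evT θ) = 0 := by
      linear_combination e * h2 - F.evT θ * h3
    have hc₂ : c₂ = 0 := by
      refine (mul_eq_zero.mp h4).resolve_right fun h0 => ?_
      have h5 := congrArg F.res h0
      rw [map_sub, map_mul, map_mul, map_mul, F.res_form_self, ← F.resA_apply, ← F.resT_apply,
        ← F.resT_apply, hRη, hTθ, map_zero, zero_mul, zero_mul, zero_sub, neg_eq_zero] at h5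
      exact mul_ne_zero (excess_monic A H).ne_zero Lagrange.nodal_ne_zero h5
    rw [hc₂, zero_mul, add_zero] at h2
    exact ⟨(mul_eq_zero.mp h2).resolve_right hT0, hc₂⟩
  · intro ζ hζ
    have hspan : ζ ∈ Submodule.span (MvPolynomial (Fin 3) K) {θ, F.form • η} := by
      rw [← sum_homogeneousComponent_prod ζ]
      exact sum_mem fun k _ => hgen k _ (homogeneousComponent_mem_logDerDeg hζ k)
    obtain ⟨c₁, c₂, h⟩ := Submodule.mem_span_pair.mp hspan
    exact ⟨c₁, c₂, h.symm⟩

theorem card_pts_mono {A C : Finset (Set (K × K))} (h : C ⊆ A) (H : Set (K × K)) :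
    (pts C H).card ≤ (pts A H).card := by
  classical
  refine Finset.card_le_card (Finset.image_subset_image fun L hL => ?_)
  rw [mem_crossers] at hL ⊢
  exact ⟨h hL.1, hL.2⟩

theorem b2_le_of_card_pts_le {A B : Finset (Set (K × K))} (hA : IsLineArr A) (hBA : B ⊆ A)
    {m : ℕ} (hm : ∀ H ∈ A, (pts A H).card ≤ m) :
    b2 A ≤ b2 B + (A.card - B.card) * m := by
  classical
  have key : ∀ D : Finset (Set (K × K)), D ⊆ A \ B → b2 (B ∪ D) ≤ b2 B + D.card * m := by
    intro D
    induction D using Finset.induction_on with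
    | empty => simp
    | insert H D hHD ih =>
      intro hD
      obtain ⟨hH, hD⟩ := Finset.insert_subset_iff.mp hD
      obtain ⟨hHA, hHB⟩ := Finset.mem_sdiff.mp hH
      have hsub : B ∪ D ⊆ A := Finset.union_subset hBA (hD.trans Finset.sdiff_subset)
      have hpts := (card_pts_mono hsub H).trans (hm H hHA)
      rw [Finset.union_insert, b2_insert (hA.mono hsub) (hA H hHA) (by simp [hHB, hHD]),
        Finset.card_insert_of_notMem hHD]
      have := ih hD
      push_cast
      nlinarith
  have h := key (A \ B) subset_rfl
  rw [Finset.union_sdiff_of_subset hBA, Finset.card_sdiff_of_subset hBA,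
    Nat.cast_sub (Finset.card_le_card hBA)] at h
  exact h

theorem card_eq_and_b2_eq_of_chi_eq {E : Type*} {A : Finset (Set (E × E))} {n r : ℕ}
    (hchi : ∀ t : ℂ, chi A t = (t - (n : ℂ)) * (t - (n : ℂ) - (r : ℂ))) :
    A.card = 2 * n + r ∧ b2 A = n * (n + r) := by
  have h0 := hchi 0
  have h1 := hchi 1
  rw [chi] at h0 h1
  have e0 : (b2 A : ℂ) = ((n * (n + r) : ℤ) : ℂ) := by
    push_cast
    linear_combination h0
  have e1 : (A.card : ℂ) = ((2 * n + r : ℕ) : ℂ) := by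
    push_cast
    linear_combination h0 - h1
  exact ⟨by exact_mod_cast e1, by exact_mod_cast e0⟩

/-- **Proposition 5.1**. Let `χ(A,t) = (t−n)(t−n−r)` with `r ≥ 1`, and assume `A` contains
a free subarrangement `B` with `exp₀(B) = (n−2, n−2)`. Then `A` is free iff `n_H = n` or
`n_H = n + r` for some `H ∈ A`. -/
theorem free_iff_exists_line_exp_n2_n2
    {K : Type*} [Field K] (A : Finset (Set (K × K))) (hA : IsLineArr A)
    (n r : ℕ) (hr : 1 ≤ r)
    (hchi : ∀ t : ℂ, chi A t = (t - (n : ℂ)) * (t - (n : ℂ) - (r : ℂ)))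
    (B : Finset (Set (K × K))) (hBA : B ⊆ A)
    (hBfree : IsFreeExpZ B ((n : ℤ) - 2) ((n : ℤ) - 2)) :
    IsFree A ↔ ∃ H ∈ A, nOn A H = n ∨ nOn A H = n + r := by

  classical
  obtain ⟨hcard, hb2⟩ := card_eq_and_b2_eq_of_chi_eq hchi
  have hsplit : ∀ H ∈ A, nOn A H = (pts (A.erase H) H).card := fun H hH => by
    rw [nOn_eq_card_pts hA (hA H hH), ← pts_insert (A.erase H), Finset.insert_erase hH]
  obtain ⟨e, e', he, he', hB⟩ := hBfree
  obtain ⟨_, _, hBbasis⟩ := hB.exists_isLogBasis (hA.mono hBA)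
  constructor
  · rintro ⟨d₁, d₂, hfree⟩
    obtain ⟨θ₁, θ₂, hbasis⟩ := hfree.exists_isLogBasis hA
    obtain ⟨hs, hp⟩ := hbasis.add_eq_and_mul_eq hA
    have hroots : ((d₁ : ℤ) - n) * (d₁ - (n + r)) = 0 := by
      have hs' : (d₁ + d₂ : ℤ) = 2 * n + r := by
        rw [hcard] at hs
        exact_mod_cast hs
      linear_combination d₁ * hs' - hp - hb2
    obtain ⟨θ, θ', hbasis'⟩ : ∃ θ θ', IsLogBasis A n (n + r) θ θ' := by
      rcases mul_eq_zero.mp hroots with h | h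
      · obtain rfl : d₁ = n := by omega
        obtain rfl : d₂ = d₁ + r := by omega
        exact ⟨_, _, hbasis⟩
      · obtain rfl : d₁ = n + r := by omega
        obtain rfl : d₂ = n := by omega
        exact ⟨_, _, hbasis.symm⟩
    obtain ⟨H, hH, hn⟩ : ∃ H ∈ A, n ≤ nOn A H := by
      by_contra! hlt
      obtain ⟨hBs, hBp⟩ := hBbasis.add_eq_and_mul_eq (hA.mono hBA)
      have hle := b2_le_of_card_pts_le hA hBA (m := n - 1) fun H hH => by
        rw [← nOn_eq_card_pts hA (hA H hH)]
        exact Nat.le_sub_one_of_lt (hlt H hH)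
      rw [hb2, ← hBp, ← hBs, hcard, Nat.cast_sub (by omega : 1 ≤ n)] at hle
      push_cast at hle
      rw [he, he'] at hle
      have hr' : (1 : ℤ) ≤ r := by exact_mod_cast hr
      nlinarith
    refine ⟨H, hH, (eq_or_lt_of_le hn).imp Eq.symm fun hlt => ?_⟩
    rw [hsplit H hH] at hlt ⊢
    refine IsLogBasis.card_pts_eq (hA.mono (Finset.erase_subset H A)) (hA H hH)
      (Finset.notMem_erase H A) (θ₁ := θ) (θ₂ := θ') ?_ ?_ hlt
    · rwa [Finset.insert_erase hH]
    · rw [Finset.card_erase_add_one hH]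
      omega
  · rintro ⟨H, hH, hn⟩
    rw [hsplit H hH] at hn
    have key : ∀ a b : ℕ, (pts (A.erase H) H).card = a → 1 ≤ a → 1 ≤ b → a + b = 2 * n + r →
        a * b = n * (n + r) → IsFree A := by
      intro a b ha ha1 hb1 hsum hmul
      obtain ⟨θ₁, θ₂, h⟩ := exists_isLogBasis_of_mul_eq (hA.mono (Finset.erase_subset H A))
        (hA H hH) (Finset.notMem_erase H A) ha ha1 hb1
        (by rw [Finset.card_erase_add_one hH, hsum, hcard])
        (by rw [Finset.insert_erase hH, hb2]; exact_mod_cast hmul)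
      rw [Finset.insert_erase hH] at h
      exact ⟨a, b, h.isFreeExp hA⟩
    rcases hn with hn | hn
    · exact key n (n + r) hn (by omega) (by omega) (by ring) rfl
    · exact key (n + r) n hn (by omega) (by omega) (by ring) (mul_comm _ _)
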